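/- arXiv:2305.05219 — 2 statements merged into one kernel-verified Lean document; each statement's English description precedes it below -/
import Mathlib

section
/- Procesi–Schwarz theorem: let G be a compact subgroup of the orthogonal group O_n(ℝ) and let π_1, …, π_m be fundamental invariants, i.e. generators of the invariant algebra ℝ[x_1, …, x_n]^G. Let Π : ℝ^n → ℝ^m be the Hilbert map x ↦ (π_1(x), …, π_m(x)), let I ⊆ ℝ[z_1, …, z_m] be the ideal of relations I = {q : q(π_1, …, π_m) = 0}, and let q_{ij} ∈ ℝ[z_1, …, z_m] (1 ≤ i, j ≤ m) be polynomials satisfying q_{ij}(π_1(x), …, π_m(x)) = Σ_{k=1}^n (∂π_i/∂x_k)(x)·(∂π_j/∂x_k)(x) for all x ∈ ℝ^n (such polynomials exist since these inner products of differentials are G-invariant). Then the image of the Hilbert map — the orbit space ℝ^n/G — equals the basic semialgebraic set Π(ℝ^n) = { z ∈ ℝ^m : q(z) = 0 for all q ∈ I, and the matrix J(z) := (q_{ij}(z))_{1 ≤ i,j ≤ m} is positive semidefinite }. -/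
open MvPolynomial Matrix

set_option synthInstance.maxHeartbeats 1000000
set_option maxHeartbeats 1000000

/-- The action of an invertible matrix `M` on polynomials by linear change of variables:
`X_i ↦ Σ_j M i j • X_j`. -/
noncomputable def polyAct {K : Type*} [CommSemiring K] {n : ℕ}
    (M : Matrix (Fin n) (Fin n) K) :
    MvPolynomial (Fin n) K →ₐ[K] MvPolynomial (Fin n) K :=
  MvPolynomial.aeval (fun i => ∑ j, M i j • MvPolynomial.X j)

/-- The action of an element `g` of a subgroup `H` of the orthogonal group `O_n(ℝ)` on
polynomials: `f^g := f ∘ g⁻¹`. -/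
noncomputable def orthAct {n : ℕ} (H : Subgroup (Matrix.orthogonalGroup (Fin n) ℝ))
    (g : ↥H) : MvPolynomial (Fin n) ℝ →ₐ[ℝ] MvPolynomial (Fin n) ℝ :=
  polyAct ((((g⁻¹ : ↥H) : Matrix.orthogonalGroup (Fin n) ℝ) : Matrix (Fin n) (Fin n) ℝ))

section psHelpers

open MeasureTheory

/-- complexified action of a real matrix -/
noncomputable def psAct {n : ℕ} (M : Matrix (Fin n) (Fin n) ℝ) (y : Fin n → ℂ) : Fin n → ℂ :=
  fun i => ∑ j, (M i j : ℂ) * y j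

theorem ps_exists_haar (K : Type) [Group K] [TopologicalSpace K] [IsTopologicalGroup K]
    [CompactSpace K] [MeasurableSpace K] [BorelSpace K] :
    ∃ μ : Measure K, IsProbabilityMeasure μ ∧ μ.IsMulLeftInvariant ∧ μ.IsMulRightInvariant := by
  let K0 : TopologicalSpace.PositiveCompacts K := ⊤
  let μ := Measure.haarMeasure K0
  have hp : IsProbabilityMeasure μ :=
    ⟨by have := Measure.haarMeasure_self (K₀ := K0); simpa [K0] using this⟩
  refine ⟨μ, hp, inferInstance, ⟨fun g => ?_⟩⟩
  have : IsProbabilityMeasure (Measure.map (· * g) μ) :=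
    Measure.isProbabilityMeasure_map (by fun_prop)
  have h := Measure.isMulInvariant_eq_smul_of_compactSpace (Measure.map (· * g) μ) μ
  have h1 := congrArg (fun ν => ν Set.univ) h
  simp [Measure.smul_apply] at h1
  rw [h, ← h1]
  simp

theorem ps_aeval_polyAct {n : ℕ} (M : Matrix (Fin n) (Fin n) ℝ) (y : Fin n → ℂ)
    (f : MvPolynomial (Fin n) ℝ) : aeval y (polyAct M f) = aeval (psAct M y) f := by
  have : (aeval y).comp (polyAct M) = (aeval (psAct M y) : MvPolynomial (Fin n) ℝ →ₐ[ℝ] ℂ) := by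
    apply MvPolynomial.algHom_ext
    intro i
    simp [polyAct, psAct]
  exact congrArg (fun g => g f) this

theorem ps_polyAct_mul {n : ℕ} (M N : Matrix (Fin n) (Fin n) ℝ)
    (f : MvPolynomial (Fin n) ℝ) : polyAct N (polyAct M f) = polyAct (M * N) f := by
  have : (polyAct N).comp (polyAct M) = polyAct (M * N) := by
    apply MvPolynomial.algHom_ext
    intro i
    simp only [polyAct, AlgHom.comp_apply, aeval_X, map_sum, map_smul, Finset.smul_sum,
      Matrix.mul_apply, Finset.sum_smul, smul_smul]
    rw [Finset.sum_comm]
  exact congrArg (fun g => g f) this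

theorem ps_pderiv_polyAct {n : ℕ} (M : Matrix (Fin n) (Fin n) ℝ) (k : Fin n)
    (f : MvPolynomial (Fin n) ℝ) :
    pderiv k (polyAct M f) = ∑ j, M j k • polyAct M (pderiv j f) := by
  induction f using MvPolynomial.induction_on with
  | C a =>
    have : polyAct M (C a) = C a := by simp [polyAct, algebraMap_eq]
    simp [this]
  | add p q hp hq => simp [hp, hq, Finset.sum_add_distrib]
  | mul_X p i hp =>
    rw [map_mul, Derivation.leibniz, hp]
    have h1 : polyAct M (X i) = ∑ j, M i j • (X j : MvPolynomial (Fin n) ℝ) := by simp [polyAct]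
    have h2 : pderiv k (polyAct M (X i)) = C (M i k) := by
      rw [h1, map_sum, Finset.sum_eq_single k]
      · simp [smul_eq_C_mul]
      · intro b _ hb; simp [pderiv_X, hb]
      · simp
    rw [h2]
    simp only [Derivation.leibniz, map_add, smul_add, Finset.sum_add_distrib, smul_eq_mul, map_mul]
    congr 1
    · rw [Finset.sum_eq_single i]
      · simp [smul_eq_C_mul]; ring
      · intro b _ hb; simp [pderiv_X, hb.symm]
      · simp
    · rw [Finset.mul_sum]; refine Finset.sum_congr rfl fun j _ => ?_
      simp

/-- the polynomial action is a finite sum of continuous functions times fixed polynomials -/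
theorem ps_polyAct_fin {n : ℕ} (f : MvPolynomial (Fin n) ℝ) :
    ∃ (N : ℕ) (c : Fin N → Matrix (Fin n) (Fin n) ℝ → ℝ) (p : Fin N → MvPolynomial (Fin n) ℝ),
      (∀ k, Continuous (c k)) ∧ ∀ M, polyAct M f = ∑ k, c k M • p k := by
  induction f using MvPolynomial.induction_on with
  | C a =>
    refine ⟨1, fun _ _ => 1, fun _ => C a, fun _ => continuous_const, fun M => ?_⟩
    simp [polyAct, algebraMap_eq]
  | add p q hp hq =>
    obtain ⟨N, c, p', hc, h⟩ := hp
    obtain ⟨N', c', q', hc', h'⟩ := hq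
    refine ⟨N + N', Fin.append c c', Fin.append p' q', ?_, fun M => ?_⟩
    · intro k
      refine Fin.addCases (fun i => ?_) (fun i => ?_) k
      · simpa using hc i
      · simpa using hc' i
    · rw [map_add, h, h', Fin.sum_univ_add]; simp
  | mul_X p i hp =>
    obtain ⟨N, c, p', hc, h⟩ := hp
    refine ⟨N * n, fun k M => c k.divNat M * M i k.modNat, fun k => p' k.divNat * X k.modNat,
      ?_, fun M => ?_⟩
    · intro k
      exact (hc _).mul (by fun_prop)
    · rw [map_mul, h]
      have h1 : polyAct M (X i) = ∑ j, M i j • (X j : MvPolynomial (Fin n) ℝ) := by simp [polyAct]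
      rw [h1, Finset.sum_mul_sum, ← finProdFinEquiv.sum_comp, Fintype.sum_prod_type]
      refine Finset.sum_congr rfl fun k _ => Finset.sum_congr rfl fun l _ => ?_
      have e1 : (finProdFinEquiv (k, l)).divNat = k := congrArg Prod.fst
        (finProdFinEquiv.symm_apply_apply (k, l))
      have e2 : (finProdFinEquiv (k, l)).modNat = l := congrArg Prod.snd
        (finProdFinEquiv.symm_apply_apply (k, l))
      simp only [e1, e2, smul_mul_smul_comm]

section avg
variable {n : ℕ} {K : Type} [Group K] [TopologicalSpace K] [IsTopologicalGroup K] [CompactSpace K]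
    [MeasurableSpace K] [BorelSpace K]

theorem ps_avg (μ : Measure K) [IsProbabilityMeasure μ] [μ.IsMulLeftInvariant]
    [μ.IsMulRightInvariant] (ρ : K →* Matrix (Fin n) (Fin n) ℝ) (hρ : Continuous ρ)
    (f : MvPolynomial (Fin n) ℝ) :
    ∃ p : MvPolynomial (Fin n) ℝ, (∀ g, polyAct (ρ g) p = p) ∧
      ∀ T : MvPolynomial (Fin n) ℝ →ₗ[ℝ] ℂ, T p = ∫ h, T (polyAct (ρ h) f) ∂μ := by
  obtain ⟨N, c, q, hc, h⟩ := ps_polyAct_fin f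
  have hT : ∀ T : MvPolynomial (Fin n) ℝ →ₗ[ℝ] ℂ, T (∑ k, (∫ h, c k (ρ h) ∂μ) • q k)
      = ∫ h, T (polyAct (ρ h) f) ∂μ := by
    intro T
    simp only [h, map_sum, map_smul]
    rw [integral_finsetSum]
    · refine Finset.sum_congr rfl fun k _ => ?_
      rw [integral_smul_const]
    · intro k _
      apply Continuous.integrable_of_hasCompactSupport _ (HasCompactSupport.of_compactSpace _)
      exact ((hc k).comp hρ).smul continuous_const
  refine ⟨∑ k, (∫ h, c k (ρ h) ∂μ) • q k, fun g => ?_, hT⟩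
  set p := ∑ k, (∫ h, c k (ρ h) ∂μ) • q k
  apply MvPolynomial.funext
  intro y
  have h1 := hT ((aeval (fun i => (y i : ℂ)) : MvPolynomial (Fin n) ℝ →ₐ[ℝ] ℂ).toLinearMap)
  have h2 := hT ((aeval (fun i => (y i : ℂ)) : MvPolynomial (Fin n) ℝ →ₐ[ℝ] ℂ).toLinearMap ∘ₗ
    (polyAct (ρ g)).toLinearMap)
  have h3 : ∀ r : MvPolynomial (Fin n) ℝ, aeval (fun i => (y i : ℂ)) r = ((eval y r : ℝ) : ℂ) := by
    intro r
    have := MvPolynomial.aeval_algebraMap_apply ℂ y r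
    simpa [MvPolynomial.aeval_eq_eval, Function.comp_def] using this
  simp only [AlgHom.toLinearMap_apply, LinearMap.comp_apply] at h1 h2
  rw [h3] at h1 h2
  have h4 : ∫ h, aeval (fun i => (y i : ℂ)) (polyAct (ρ g) (polyAct (ρ h) f)) ∂μ
     = ∫ h, aeval (fun i => (y i : ℂ)) (polyAct (ρ h) f) ∂μ := by
    have := integral_mul_right_eq_self (μ := μ)
      (fun h => aeval (fun i => (y i : ℂ)) (polyAct (ρ h) f)) g
    simpa [ps_polyAct_mul] using this
  rw [h4, ← h1] at h2
  exact_mod_cast h2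
end avg

/-- span of the exponentials with frequencies bounded by `B` -/
noncomputable def psW (B : ℝ) : Submodule ℂ (ℂ → ℂ) :=
  Submodule.span ℂ {f | ∃ μ : ℝ, |μ| ≤ B ∧ f = fun t => Complex.exp (Complex.I * μ * t)}

theorem psW_mono {B B' : ℝ} (h : B ≤ B') : psW B ≤ psW B' := by
  apply Submodule.span_mono
  rintro f ⟨μ, h1, h2⟩
  exact ⟨μ, h1.trans h, h2⟩

theorem psW_exp {B : ℝ} (μ : ℝ) (h : |μ| ≤ B) :
    (fun t => Complex.exp (Complex.I * μ * t)) ∈ psW B :=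
  Submodule.subset_span ⟨μ, h, rfl⟩

theorem psW_one {B : ℝ} (h : 0 ≤ B) : (1 : ℂ → ℂ) ∈ psW B := by
  have := psW_exp (B := B) 0 (by simpa using h)
  convert this using 1
  ext t; simp

theorem psW_mul {B B' : ℝ} {f g : ℂ → ℂ} (hf : f ∈ psW B) (hg : g ∈ psW B') :
    f * g ∈ psW (B + B') := by
  have h := Submodule.mul_mem_mul hf hg
  rw [psW, psW, Submodule.span_mul_span] at h
  refine (Submodule.span_le.2 ?_) h
  rintro _ ⟨_, ⟨μ, h1, rfl⟩, _, ⟨μ', h1', rfl⟩, rfl⟩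
  refine Submodule.subset_span ⟨μ + μ', (abs_add_le _ _).trans (by linarith), ?_⟩
  ext t
  simp only [Pi.mul_apply]
  rw [← Complex.exp_add]
  congr 1
  push_cast; ring

theorem psW_pow {B : ℝ} {f : ℂ → ℂ} (hf : f ∈ psW B) (k : ℕ) :
    f ^ k ∈ psW (k * B) := by
  induction k with
  | zero => simpa using psW_one le_rfl
  | succ k ih =>
    rw [pow_succ]
    have := psW_mul ih hf
    convert this using 2
    push_cast; ring

theorem psW_prod {n : ℕ} {B : ℝ} {y : Fin n → ℂ → ℂ} (hy : ∀ i, y i ∈ psW B)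
    (α : Fin n → ℕ) (s : Finset (Fin n)) :
    ∏ i ∈ s, y i ^ α i ∈ psW ((∑ i ∈ s, α i : ℕ) * B) := by
  induction s using Finset.induction_on with
  | empty => simpa using psW_one le_rfl
  | insert a s ha ih =>
    rw [Finset.prod_insert ha, Finset.sum_insert ha]
    have := psW_mul (psW_pow (hy a) (α a)) ih
    convert this using 2
    push_cast; ring

theorem psW_poly {n : ℕ} {B : ℝ} (hB : 0 ≤ B) {y : Fin n → ℂ → ℂ} (hy : ∀ i, y i ∈ psW B)
    (p : MvPolynomial (Fin n) ℝ) :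
    (fun t => aeval (fun i => y i t) p) ∈ psW (p.totalDegree * B) := by
  have : (fun t => aeval (fun i => y i t) p) =
      ∑ d ∈ p.support, ((p.coeff d : ℝ) : ℂ) • ∏ i, y i ^ d i := by
    ext t
    rw [aeval_def, eval₂_eq']
    simp
  rw [this]
  refine Submodule.sum_mem _ fun d hd => Submodule.smul_mem _ _ ?_
  refine psW_mono ?_ (psW_prod hy d Finset.univ)
  refine mul_le_mul_of_nonneg_right ?_ hB
  have := MvPolynomial.le_totalDegree hd
  rw [Finsupp.sum_fintype _ _ (by simp)] at this
  exact_mod_cast this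

theorem psW_zero {B : ℝ} (hB : B < Real.pi) {g : ℂ → ℂ} (hg : g ∈ psW B)
    (h0 : ∀ k : ℕ, g k = 0) : g = 0 := by
  classical
  have hex : ∃ (F : Finset ℝ) (c : ℝ → ℂ), (∀ μ ∈ F, |μ| ≤ B) ∧
      g = fun t => ∑ μ ∈ F, c μ * Complex.exp (Complex.I * μ * t) := by
    clear h0
    induction hg using Submodule.span_induction with
    | mem f hf =>
      obtain ⟨μ, h1, rfl⟩ := hf
      exact ⟨{μ}, fun _ => 1, by simpa using h1, by simp⟩
    | zero => exact ⟨∅, 0, by simp, by ext; simp⟩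
    | add f f' _ _ hf hf' =>
      obtain ⟨F, c, h1, rfl⟩ := hf
      obtain ⟨F', c', h1', rfl⟩ := hf'
      refine ⟨F ∪ F', fun μ => (if μ ∈ F then c μ else 0) + (if μ ∈ F' then c' μ else 0), ?_, ?_⟩
      · intro μ hμ
        rcases Finset.mem_union.1 hμ with h | h
        exacts [h1 _ h, h1' _ h]
      · ext t
        simp only [Pi.add_apply, add_mul, Finset.sum_add_distrib, ite_mul, zero_mul]
        rw [← Finset.sum_filter, ← Finset.sum_filter]
        congr 2 <;> ext μ <;> simp +contextual
    | smul a f _ hf =>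
      obtain ⟨F, c, h1, rfl⟩ := hf
      refine ⟨F, fun μ => a * c μ, h1, ?_⟩
      ext t; simp [Finset.mul_sum, mul_assoc]
  obtain ⟨F, c, hF, rfl⟩ := hex
  have hpoly : ∀ Q : Polynomial ℂ, ∑ μ ∈ F, c μ * Q.eval (Complex.exp (Complex.I * (μ : ℝ))) = 0 := by
    intro Q
    induction Q using Polynomial.induction_on' with
    | add p q hp hq => simp [mul_add, Finset.sum_add_distrib, hp, hq]
    | monomial k a =>
      have := h0 k
      have h2 : ∀ μ : ℝ, Complex.exp (Complex.I * μ * k) = Complex.exp (Complex.I * μ) ^ k := by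
        intro μ; rw [← Complex.exp_nat_mul]; ring_nf
      simp only [h2] at this
      have h3 := congrArg (fun w => a * w) this
      simp only [Finset.mul_sum, mul_zero] at h3
      rw [← h3]
      refine Finset.sum_congr rfl fun μ _ => ?_
      simp; ring
  have hinj : Set.InjOn (fun μ : ℝ => Complex.exp (Complex.I * μ)) F := by
    intro a ha b hb hab
    have h1 := abs_le.1 (hF a ha)
    have h2 := abs_le.1 (hF b hb)
    have := Complex.exp_inj_of_neg_pi_lt_of_le_pi (x := Complex.I * a) (y := Complex.I * b)
      (by simp; linarith) (by simp; linarith) (by simp; linarith) (by simp; linarith) hab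
    simpa using this
  ext t
  have := hpoly (Lagrange.interpolate F (fun μ : ℝ => Complex.exp (Complex.I * μ))
    (fun μ => Complex.exp (Complex.I * μ * t)))
  rw [Pi.zero_apply, ← this]
  refine Finset.sum_congr rfl fun μ hμ => ?_
  rw [Lagrange.eval_interpolate_at_node (v := fun μ : ℝ => Complex.exp (Complex.I * μ)) _ hinj hμ]

theorem ps_eig_bound {n : ℕ} {B : Matrix (Fin n) (Fin n) ℂ} {η : ℝ} (hη : 0 ≤ η)
    (hB : ∀ i j, ‖B i j‖ ≤ η) {v : Fin n → ℂ} (hv : v ≠ 0) {c : ℂ} (h : B *ᵥ v = c • v) :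
    ‖c‖ ≤ n * η := by
  have h1 : ‖B *ᵥ v‖ ≤ n * η * ‖v‖ := by
    rw [pi_norm_le_iff_of_nonneg (by positivity)]
    intro i
    have h0 : (B *ᵥ v) i = ∑ j, B i j * v j := rfl
    rw [h0]
    calc ‖∑ j, B i j * v j‖ ≤ ∑ j, ‖B i j * v j‖ := norm_sum_le _ _
      _ ≤ ∑ j : Fin n, η * ‖v‖ := by
        refine Finset.sum_le_sum fun j _ => ?_
        rw [norm_mul]
        exact mul_le_mul (hB i j) (norm_le_pi_norm v j) (norm_nonneg _) hη
      _ = n * η * ‖v‖ := by simp; ring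
  rw [h, norm_smul] at h1
  exact le_of_mul_le_mul_right h1 (norm_pos_iff.2 hv)

theorem ps_diag {n : ℕ} (h : Matrix (Fin n) (Fin n) ℝ) (ho : hᵀ * h = 1) {η : ℝ} (hη : 0 ≤ η)
    (hη1 : n * η < 1) (hh : ∀ i j, |h i j - (1 : Matrix (Fin n) (Fin n) ℝ) i j| ≤ η) :
    ∃ (U : Matrix (Fin n) (Fin n) ℂ) (l : Fin n → ℝ), Uᴴ * U = 1 ∧ U * Uᴴ = 1 ∧
      (∀ j, |l j| ≤ 2 * (n * η)) ∧
      h.map Complex.ofReal * U = U * Matrix.diagonal (fun j => Complex.exp (Complex.I * l j)) := by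
  set A : Matrix (Fin n) (Fin n) ℂ := h.map Complex.ofReal with hA
  have hAt : Aᴴ * A = 1 := by
    have : Aᴴ = hᵀ.map Complex.ofReal := by
      ext i j; simp [A, Matrix.conjTranspose_apply]
    rw [this, hA]
    have h3 := Matrix.map_mul (L := hᵀ) (M := h) (f := Complex.ofRealHom)
    rw [ho] at h3
    have h4 : (1 : Matrix (Fin n) (Fin n) ℝ).map Complex.ofRealHom = 1 :=
      Matrix.map_one _ (map_zero _) (map_one _)
    rw [h4] at h3
    exact h3.symm
  have hAt' : A * Aᴴ = 1 := mul_eq_one_comm.1 hAt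
  set S : Matrix (Fin n) (Fin n) ℂ := (-Complex.I / 2) • (A - Aᴴ) with hS
  have hSH : S.IsHermitian := by
    rw [Matrix.IsHermitian, hS, Matrix.conjTranspose_smul]
    simp [Matrix.conjTranspose_sub]
    rw [neg_div, neg_smul, ← smul_neg, neg_sub]
  have hA1 : ∀ i j, ‖(A - 1) i j‖ ≤ η := by
    intro i j
    have := hh i j
    have e : (A - 1) i j = ((h i j - (1 : Matrix (Fin n) (Fin n) ℝ) i j : ℝ) : ℂ) := by
      simp only [Matrix.sub_apply, A, Matrix.map_apply, Matrix.one_apply]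
      split_ifs <;> simp
    rw [e, Complex.norm_real]; exact this
  have hSb : ∀ i j, ‖S i j‖ ≤ η := by
    intro i j
    have e : S i j = (-Complex.I / 2) * ((A - 1) i j - star ((A - 1) j i)) := by
      simp only [hS, Matrix.smul_apply, Matrix.sub_apply, Matrix.conjTranspose_apply, smul_eq_mul,
        Matrix.one_apply, star_sub]
      by_cases hij : i = j
      · simp [hij]
      · simp [hij, Ne.symm hij]
    rw [e, norm_mul]
    have h1 := norm_sub_le ((A - 1) i j) (star ((A - 1) j i))
    rw [norm_star] at h1
    have h2 : ‖(-Complex.I / 2)‖ = 1 / 2 := by simp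
    rw [h2]
    linarith [hA1 i j, hA1 j i]
  set U : Matrix (Fin n) (Fin n) ℂ := (hSH.eigenvectorUnitary : Matrix (Fin n) (Fin n) ℂ) with hU
  have hU1 : Uᴴ * U = 1 := by
    exact (Matrix.mem_unitaryGroup_iff'.1 hSH.eigenvectorUnitary.2)
  have hU2 : U * Uᴴ = 1 := mul_eq_one_comm.1 hU1
  let v : Fin n → Fin n → ℂ := fun j i => U i j
  have hv : ∀ j, S *ᵥ v j = (hSH.eigenvalues j : ℂ) • v j := by
    intro j
    have := hSH.mulVec_eigenvectorBasis j
    have e : v j = (hSH.eigenvectorBasis j).ofLp := by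
      ext i; simp [v, U]
    rw [e, this]; ext i; simp
  have hv0 : ∀ j, v j ≠ 0 := by
    intro j h0
    have := congrFun (congrFun hU1 j) j
    rw [Matrix.mul_apply] at this
    have h3 : ∀ i, U i j = 0 := fun i => congrFun h0 i
    simp [h3] at this
  have hσ : ∀ j, |hSH.eigenvalues j| ≤ n * η := by
    intro j
    have := ps_eig_bound hη hSb (hv0 j) (hv j)
    simpa using this
  refine ⟨U, fun j => Real.arcsin (hSH.eigenvalues j), hU1, hU2, ?_, ?_⟩
  · intro j
    set σ := hSH.eigenvalues j
    have h1 := hσ j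
    have h2 := abs_le.1 h1
    have hs : Real.sin (Real.arcsin σ) = σ := Real.sin_arcsin (by linarith) (by linarith)
    have hl := Real.arcsin_mem_Icc σ
    have h3 : 2 / Real.pi * |Real.arcsin σ| ≤ Real.sin |Real.arcsin σ| :=
      Real.mul_le_sin (abs_nonneg _) (abs_le.2 ⟨by linarith [hl.1], hl.2⟩)
    have h4 : Real.sin |Real.arcsin σ| ≤ |σ| := by
      rcases abs_cases (Real.arcsin σ) with ⟨h, _⟩ | ⟨h, _⟩ <;> rw [h]
      · rw [hs]; exact le_abs_self _
      · rw [Real.sin_neg, hs]; exact neg_le_abs _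
    have hpi : (1 : ℝ) / 2 ≤ 2 / Real.pi := by
      rw [div_le_div_iff₀ (by norm_num) Real.pi_pos]; linarith [Real.pi_le_four]
    have : 1 / 2 * |Real.arcsin σ| ≤ 2 / Real.pi * |Real.arcsin σ| :=
      mul_le_mul_of_nonneg_right hpi (abs_nonneg _)
    linarith
  · have key : ∀ j, A *ᵥ v j = Complex.exp (Complex.I * Real.arcsin (hSH.eigenvalues j)) • v j := by
      intro j
      set σ := hSH.eigenvalues j with hσd
      have h2 := abs_le.1 (hσ j)
      set l := Real.arcsin σ with hl
      have hs : Real.sin l = σ := Real.sin_arcsin (by linarith) (by linarith)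
      have hcos : 0 ≤ Real.cos l := Real.cos_arcsin_nonneg σ
      set c := Complex.exp (Complex.I * l) with hc
      set c' := Complex.exp (-(Complex.I * l)) with hc'
      have hcc : c * c' = 1 := by rw [hc, hc', ← Complex.exp_add]; simp
      have hcv : c = Real.cos l + Complex.I * σ := by
        rw [hc, mul_comm, Complex.exp_mul_I, ← hs]; push_cast; ring
      have hcv' : c' = Real.cos l - Complex.I * σ := by
        rw [hc', show -(Complex.I * (l : ℂ)) = (-l : ℂ) * Complex.I by ring, Complex.exp_mul_I,
          Complex.cos_neg, Complex.sin_neg, ← hs]; push_cast; ring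
      have hsub : c - c' = 2 * Complex.I * σ := by rw [hcv, hcv']; ring
      by_contra hne
      set w := A *ᵥ v j - c • v j with hw
      have hw0 : w ≠ 0 := sub_ne_zero.2 hne
      have hAA : A *ᵥ (A *ᵥ v j) = v j + (2 * Complex.I * σ) • (A *ᵥ v j) := by
        have e1 : A * (A - Aᴴ) = A * ((2 * Complex.I) • S) := by
          rw [hS, smul_smul]; congr 1
          have : 2 * Complex.I * (-Complex.I / 2) = 1 := by
            ring_nf; simp
          rw [this, one_smul]
        have e2 : A * A = 1 + (2 * Complex.I) • (A * S) := by
          rw [mul_sub, hAt', Matrix.mul_smul] at e1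
          rw [← e1]; abel
        rw [Matrix.mulVec_mulVec, e2, Matrix.add_mulVec, Matrix.one_mulVec, Matrix.smul_mulVec,
          ← Matrix.mulVec_mulVec, hv j, Matrix.mulVec_smul, smul_smul]
      have hAw : (A - 1) *ᵥ w = (-(1 + c')) • w := by
        have e1 : A *ᵥ w = -c' • w := by
          rw [hw, Matrix.mulVec_sub, hAA, Matrix.mulVec_smul, ← hsub]
          ext i
          simp only [Pi.sub_apply, Pi.add_apply, Pi.smul_apply, smul_eq_mul]
          linear_combination (-v j i) * hcc
        rw [Matrix.sub_mulVec, Matrix.one_mulVec, e1]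
        ext i; simp; ring
      have hb := ps_eig_bound hη hA1 hw0 hAw
      have h5 : (1 + c').re = 1 + Real.cos l := by rw [hcv']; simp [Complex.cos_ofReal_re]
      have h6 := Complex.re_le_norm (1 + c')
      rw [norm_neg] at hb
      linarith
    ext i j
    have := congrFun (key j) i
    rw [Matrix.mul_diagonal, Matrix.mul_apply]
    simp only [Matrix.mulVec, dotProduct, Pi.smul_apply, smul_eq_mul, v] at this
    rw [this]; ring

theorem ps_star_dot {n : ℕ} {U : Matrix (Fin n) (Fin n) ℂ} (hU : Uᴴ * U = 1) (v w : Fin n → ℂ) :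
    star (U *ᵥ v) ⬝ᵥ (U *ᵥ w) = star v ⬝ᵥ w := by
  rw [Matrix.star_mulVec, Matrix.dotProduct_mulVec, Matrix.vecMul_vecMul, hU, Matrix.vecMul_one]

theorem ps_normsq {n : ℕ} (v : Fin n → ℂ) :
    ((∑ i, ‖v i‖ ^ 2 : ℝ) : ℂ) = star v ⬝ᵥ v := by
  simp only [dotProduct, Pi.star_apply, Complex.ofReal_sum]
  refine Finset.sum_congr rfl fun i _ => ?_
  rw [← Complex.normSq_eq_norm_sq, Complex.normSq_eq_conj_mul_self]; rfl

theorem ps_normsq_mulVec {n : ℕ} {U : Matrix (Fin n) (Fin n) ℂ} (hU : Uᴴ * U = 1)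
    (v : Fin n → ℂ) : ∑ i, ‖(U *ᵥ v) i‖ ^ 2 = ∑ i, ‖v i‖ ^ 2 := by
  have h1 := ps_normsq (U *ᵥ v)
  rw [ps_star_dot hU, ← ps_normsq] at h1
  exact_mod_cast h1

theorem ps_psAct_eq {n : ℕ} (M : Matrix (Fin n) (Fin n) ℝ) (y : Fin n → ℂ) :
    psAct M y = M.map Complex.ofReal *ᵥ y := rfl

theorem ps_sin_bound {ε l : ℝ} (hl1 : |l| ≤ 1) (hl : |l| ≤ ε) :
    |Real.sin l - l| ≤ ε * ‖Complex.exp (Complex.I * l) - 1‖ ^ 2 := by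
  have hc : ‖Complex.exp (Complex.I * l) - 1‖ ^ 2 = 2 - 2 * Real.cos l := by
    rw [← Complex.normSq_eq_norm_sq, mul_comm, Complex.exp_mul_I, Complex.normSq_apply]
    simp [Complex.cos_ofReal_re, Complex.sin_ofReal_re]
    nlinarith [Real.sin_sq_add_cos_sq l]
  rw [hc]
  have hpi := Real.pi_gt_three
  have h1 := Real.cos_le_one_sub_mul_cos_sq (x := l) (by linarith)
  have h2 : 1 / 8 ≤ 2 / Real.pi ^ 2 := by
    rw [div_le_div_iff₀ (by norm_num) (by positivity)]; nlinarith [Real.pi_le_four]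
  have h3 : l ^ 2 / 4 ≤ 2 - 2 * Real.cos l := by
    nlinarith [mul_le_mul_of_nonneg_right h2 (sq_nonneg l)]
  have h4 := Real.sin_bound hl1
  have h5 : |Real.sin l - l| ≤ |l| ^ 3 / 6 + |l| ^ 5 / 100 := by
    have : Real.sin l - l = (Real.sin l - (l - l ^ 3 / 6)) + (-(l ^ 3 / 6)) := by ring
    rw [this]
    refine (abs_add_le _ _).trans ?_
    rw [abs_neg, abs_div, abs_pow]; norm_num; linarith
  have h6 : |l| ^ 5 ≤ |l| ^ 3 := pow_le_pow_of_le_one (abs_nonneg _) hl1 (by norm_num)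
  have h7 : |l| ^ 3 ≤ ε * l ^ 2 := by
    rw [← sq_abs l]; have := mul_le_mul_of_nonneg_right hl (sq_nonneg |l|); nlinarith
  have h8 : ε * (l ^ 2 / 4) ≤ ε * (2 - 2 * Real.cos l) :=
    mul_le_mul_of_nonneg_left h3 ((abs_nonneg _).trans hl)
  have h9 : 0 ≤ |l| ^ 3 := by positivity
  linarith

theorem ps_near1 {n m : ℕ} (π : Fin m → MvPolynomial (Fin n) ℝ) (z : Fin m → ℝ) (x : Fin n → ℂ)
    (hmin : ∀ y : Fin n → ℂ, (∀ i, aeval y (π i) = (z i : ℂ)) →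
      ∑ i, ‖x i‖ ^ 2 ≤ ∑ i, ‖y i‖ ^ 2) {ε : ℝ} (hε : 0 < ε) :
    ∃ η > 0, ∀ h : Matrix (Fin n) (Fin n) ℝ, hᵀ * h = 1 →
      (∀ i j, |h i j - (1 : Matrix (Fin n) (Fin n) ℝ) i j| ≤ η) →
      (∀ (k : ℕ) (i), aeval (psAct (h ^ k) x) (π i) = (z i : ℂ)) →
      |(star x ⬝ᵥ psAct h x).im| ≤ ε * ∑ i, ‖(psAct h x - x) i‖ ^ 2 := by
  obtain ⟨d, hd⟩ : ∃ d : ℕ, ∀ i, (π i).totalDegree ≤ d :=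
    ⟨∑ i, (π i).totalDegree, fun i => Finset.single_le_sum (f := fun i => (π i).totalDegree)
      (fun _ _ => Nat.zero_le _) (Finset.mem_univ i)⟩
  -- the bound on the eigen-angles
  obtain ⟨B, hB0, hB1, hBε, hBd⟩ : ∃ B : ℝ, 0 < B ∧ B ≤ 1 ∧ B ≤ ε ∧ d * B ≤ 1 := by
    refine ⟨min (min 1 ε) (1 / (d + 1)), by positivity, (min_le_left _ _).trans (min_le_left _ _),
      (min_le_left _ _).trans (min_le_right _ _), ?_⟩
    have h1 : min (min 1 ε) (1 / (d + 1 : ℝ)) ≤ 1 / (d + 1) := min_le_right _ _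
    have h2 := mul_le_mul_of_nonneg_left h1 (Nat.cast_nonneg (α := ℝ) d)
    refine h2.trans ?_
    rw [mul_one_div, div_le_one (by positivity)]; linarith
  refine ⟨B / (2 * (n + 1)), by positivity, fun h ho hh hfib => ?_⟩
  have hnη : n * (B / (2 * (n + 1))) ≤ B / 2 := by
    rw [mul_div_assoc', div_le_div_iff₀ (by positivity) (by norm_num)]
    nlinarith [Nat.cast_nonneg (α := ℝ) n]
  obtain ⟨U, l, hU1, hU2, hl, hdiag⟩ := ps_diag h ho (η := B / (2 * (n + 1))) (by positivity)
    (by linarith) hh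
  have hl' : ∀ j, |l j| ≤ B := fun j => (hl j).trans (by linarith)
  set A := h.map Complex.ofReal with hA
  set ξ := Uᴴ *ᵥ x with hξ
  have hx : x = U *ᵥ ξ := by rw [hξ, Matrix.mulVec_mulVec, hU2, Matrix.one_mulVec]
  let Y : ℂ → Fin n → ℂ := fun t j => Complex.exp (Complex.I * l j * t) * ξ j
  have hstep : ∀ v, A *ᵥ (U *ᵥ v) = U *ᵥ (fun j => Complex.exp (Complex.I * l j) * v j) := by
    intro v
    rw [Matrix.mulVec_mulVec, hdiag, ← Matrix.mulVec_mulVec]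
    congr 1
    ext j; rw [Matrix.mulVec_diagonal]
  have hpow : ∀ k : ℕ, psAct (h ^ k) x = U *ᵥ Y k := by
    intro k
    induction k with
    | zero =>
      rw [ps_psAct_eq, pow_zero, Matrix.map_one _ Complex.ofReal_zero Complex.ofReal_one,
        Matrix.one_mulVec]
      rw [hx]; congr 1; ext j; simp [Y]
    | succ k ih =>
      have e : psAct (h ^ (k + 1)) x = A *ᵥ psAct (h ^ k) x := by
        rw [ps_psAct_eq, ps_psAct_eq, Matrix.mulVec_mulVec, pow_succ']
        congr 1
        exact Matrix.map_mul (L := h) (M := h ^ k) (f := Complex.ofRealHom)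
      rw [e, ih, hstep]
      congr 1; ext j
      simp only [Y]
      rw [← mul_assoc, ← Complex.exp_add]
      congr 2; push_cast; ring
  -- the whole complex curve is in the fibre
  have hcurve : ∀ (t : ℂ) (i), aeval (U *ᵥ Y t) (π i) = (z i : ℂ) := by
    intro t i
    have hmem : ∀ a, (fun t => (U *ᵥ Y t) a) ∈ psW B := by
      intro a
      have : (fun t => (U *ᵥ Y t) a) =
          ∑ j, (U a j * ξ j) • fun t => Complex.exp (Complex.I * l j * t) := by
        ext t
        simp only [Matrix.mulVec, dotProduct, Y, Finset.sum_apply, Pi.smul_apply, smul_eq_mul]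
        refine Finset.sum_congr rfl fun j _ => ?_
        ring
      rw [this]
      exact Submodule.sum_mem _ fun j _ => Submodule.smul_mem _ _ (psW_exp _ (hl' j))
    have h1 := psW_poly hB0.le hmem (π i)
    have h2 : (fun t => aeval (U *ᵥ Y t) (π i)) - (z i : ℂ) • (1 : ℂ → ℂ) ∈ psW 1 := by
      refine Submodule.sub_mem _ (psW_mono ?_ h1) (Submodule.smul_mem _ _ (psW_one zero_le_one))
      refine le_trans ?_ hBd
      exact mul_le_mul_of_nonneg_right (by exact_mod_cast hd i) hB0.le
    have h3 := psW_zero (by linarith [Real.pi_gt_three]) h2 (by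
      intro k
      have := hfib k i
      rw [hpow] at this
      simp [this])
    have h4 := congrFun h3 t
    simp only [Pi.sub_apply, Pi.smul_apply, Pi.one_apply, smul_eq_mul, mul_one,
      Pi.zero_apply] at h4
    exact sub_eq_zero.1 h4
  have hxn : ∑ i, ‖x i‖ ^ 2 = ∑ j, ‖ξ j‖ ^ 2 := by
    conv_lhs => rw [hx]
    exact ps_normsq_mulVec hU1 ξ
  have hmom : ∑ j, l j * ‖ξ j‖ ^ 2 = 0 := by
    let F : ℝ → ℝ := fun τ => ∑ j, Real.exp (2 * l j * τ) * ‖ξ j‖ ^ 2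
    have hF : ∀ τ, F 0 ≤ F τ := by
      intro τ
      have h1 := hmin _ (hcurve (-Complex.I * τ))
      rw [ps_normsq_mulVec hU1, hxn] at h1
      simp only [F, mul_zero, Real.exp_zero, one_mul]
      refine h1.trans (le_of_eq ?_)
      refine Finset.sum_congr rfl fun j _ => ?_
      simp only [Y, norm_mul, mul_pow]
      congr 1
      have : Complex.I * l j * (-Complex.I * τ) = ((l j * τ : ℝ) : ℂ) := by
        push_cast; linear_combination (-(l j : ℂ) * τ) * Complex.I_mul_I
      rw [this, Complex.norm_exp_ofReal, ← Real.exp_nat_mul]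
      congr 1; push_cast; ring
    have hder : HasDerivAt F (∑ j, (2 * l j) * ‖ξ j‖ ^ 2) 0 := by
      have : ∀ j ∈ Finset.univ, HasDerivAt (fun τ => Real.exp (2 * l j * τ) * ‖ξ j‖ ^ 2)
          ((2 * l j) * ‖ξ j‖ ^ 2) 0 := by
        intro j _
        have h1 : HasDerivAt (fun τ : ℝ => 2 * l j * τ) (2 * l j) 0 := by
          simpa using (hasDerivAt_id (0 : ℝ)).const_mul (2 * l j)
        have h2 := (h1.exp).mul_const (‖ξ j‖ ^ 2)
        simpa using h2
      exact HasDerivAt.fun_sum this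
    have h0 := IsLocalMin.hasDerivAt_eq_zero (Filter.Eventually.of_forall hF) hder
    have : ∑ j, (2 * l j) * ‖ξ j‖ ^ 2 = 2 * ∑ j, l j * ‖ξ j‖ ^ 2 := by
      rw [Finset.mul_sum]; exact Finset.sum_congr rfl fun j _ => by ring
    linarith
  have hAx : psAct h x = U *ᵥ (fun j => Complex.exp (Complex.I * l j) * ξ j) := by
    rw [ps_psAct_eq]; conv_lhs => rw [hx]
    exact hstep ξ
  have him : (star x ⬝ᵥ psAct h x).im = ∑ j, (Real.sin (l j) - l j) * ‖ξ j‖ ^ 2 := by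
    have e1 : star x ⬝ᵥ psAct h x = ∑ j, Complex.exp (Complex.I * l j) * ((‖ξ j‖ ^ 2 : ℝ) : ℂ) := by
      rw [hAx]; conv_lhs => rw [hx]
      rw [ps_star_dot hU1]
      simp only [dotProduct, Pi.star_apply]
      refine Finset.sum_congr rfl fun j _ => ?_
      rw [← Complex.normSq_eq_norm_sq, Complex.normSq_eq_conj_mul_self]
      simp only [RCLike.star_def]; ring
    rw [e1, Complex.im_sum]
    simp only [sub_mul, Finset.sum_sub_distrib, hmom, sub_zero]
    refine Finset.sum_congr rfl fun j _ => ?_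
    rw [Complex.im_mul_ofReal, mul_comm Complex.I, Complex.exp_ofReal_mul_I_im]
  have hdel : ∑ i, ‖(psAct h x - x) i‖ ^ 2 =
      ∑ j, ‖Complex.exp (Complex.I * l j) - 1‖ ^ 2 * ‖ξ j‖ ^ 2 := by
    have e : psAct h x - x = U *ᵥ (fun j => (Complex.exp (Complex.I * l j) - 1) * ξ j) := by
      rw [hAx]; conv_lhs => rw [hx]
      rw [← Matrix.mulVec_sub]; congr 1; ext j; simp; ring
    rw [e, ps_normsq_mulVec hU1]
    simp [mul_pow]
  rw [him, hdel, Finset.mul_sum]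
  refine (Finset.abs_sum_le_sum_abs _ _).trans (Finset.sum_le_sum fun j _ => ?_)
  rw [abs_mul, abs_of_nonneg (sq_nonneg ‖ξ j‖), ← mul_assoc]
  exact mul_le_mul_of_nonneg_right (ps_sin_bound ((hl' j).trans hB1) ((hl' j).trans hBε))
    (sq_nonneg _)

theorem ps_seq {m : ℕ → ℝ} {c A : ℝ} (hc : 0 < c) (hA : 0 < A)
    (hm : ∀ j, c ≤ A ^ j * m j) (N : ℕ) : ∃ j, N ≤ j ∧ m j ≤ 2 * A * m (j + 1) := by
  by_contra! hcon
  have h1 : ∀ k, (2 * A) ^ k * m (N + k) ≤ m N := by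
    intro k
    induction k with
    | zero => simp
    | succ k ih =>
      have := hcon (N + k) (by omega)
      calc (2 * A) ^ (k + 1) * m (N + (k + 1)) = (2 * A) ^ k * (2 * A * m (N + k + 1)) := by
            rw [pow_succ]; ring_nf
        _ ≤ (2 * A) ^ k * m (N + k) := by gcongr
        _ ≤ m N := ih
  obtain ⟨k, hk⟩ := pow_unbounded_of_one_lt (A ^ N * m N / c) (one_lt_two (α := ℝ))
  rw [div_lt_iff₀ hc] at hk
  have h2 := hm (N + k)
  have h3 := mul_le_mul_of_nonneg_left (h1 k) (pow_pos hA N).le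
  have h4 := mul_le_mul_of_nonneg_left h2 (pow_pos (two_pos (α := ℝ)) k).le
  have h5 : A ^ N * ((2 * A) ^ k * m (N + k)) = 2 ^ k * (A ^ (N + k) * m (N + k)) := by
    rw [mul_pow, pow_add]; ring
  linarith

section laplace
variable {K : Type} [Group K] [TopologicalSpace K] [IsTopologicalGroup K] [CompactSpace K]
    [MeasurableSpace K] [BorelSpace K]

theorem ps_integrable (μ : Measure K) [IsProbabilityMeasure μ] {E : Type*} [NormedAddCommGroup E]
    {f : K → E} [SecondCountableTopologyEither K E] (hf : Continuous f) : Integrable f μ :=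
  hf.integrable_of_hasCompactSupport (HasCompactSupport.of_compactSpace _)

theorem ps_lower (μ : Measure K) [IsProbabilityMeasure μ] [μ.IsMulLeftInvariant]
    {ι : Type} [Fintype ι] [DecidableEq ι] (u : K → ι → ℝ) (hu : ∀ i, Continuous fun h => u h i)
    (D : K → ℝ) (hD : Continuous D) (hDu : ∀ h h', D (h'⁻¹ * h) = ∑ i, (u h i - u h' i) ^ 2) :
    ∃ c A : ℝ, 0 < c ∧ 1 ≤ A ∧ ∀ j : ℕ, c ≤ A ^ j * ∫ h, Real.exp (-((4 : ℝ) ^ j * D h / 2)) ∂μ := by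
  have hu' : Continuous u := continuous_pi hu
  obtain ⟨R, hR⟩ := (isCompact_range hu').isBounded.exists_norm_le
  have hR : ∀ h i, |u h i| ≤ R := fun h i =>
    (norm_le_pi_norm (u h) i).trans (hR _ ⟨h, rfl⟩)
  obtain ⟨B, hB⟩ := exists_nat_ge R
  set d := Fintype.card ι
  refine ⟨Real.exp (-(d / 2)) / (2 * B + 2) ^ d, 2 ^ d, by positivity, one_le_pow₀ (by norm_num),
    fun j => ?_⟩
  set ball : Set K := {h | D h ≤ d / 4 ^ j} with hball
  have hbm : MeasurableSet ball := (isClosed_le hD continuous_const).measurableSet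
  let cells : Finset (ι → ℤ) := Fintype.piFinset fun _ => Finset.Icc (-(B * 2 ^ j : ℤ)) (B * 2 ^ j)
  let fl : K → ι → ℤ := fun h i => ⌊u h i * 2 ^ j⌋
  have hfl : ∀ h, fl h ∈ cells := by
    intro h
    simp only [cells, Fintype.mem_piFinset, Finset.mem_Icc]
    intro i
    have h1 := abs_le.1 ((hR h i).trans hB)
    have h2 : (0 : ℝ) < 2 ^ j := by positivity
    constructor
    · apply Int.le_floor.2
      push_cast
      nlinarith
    · have := Int.floor_le (u h i * 2 ^ j)
      have h3 : ((fl h i : ℤ) : ℝ) ≤ ((B * 2 ^ j : ℤ) : ℝ) := by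
        push_cast
        calc ((fl h i : ℤ) : ℝ) ≤ u h i * 2 ^ j := this
          _ ≤ _ := by gcongr; exact h1.2
      exact_mod_cast h3
  have hcell : ∀ w, μ.real (fl ⁻¹' {w}) ≤ μ.real ball := by
    intro w
    rcases (fl ⁻¹' {w}).eq_empty_or_nonempty with he | ⟨h', hh'⟩
    · rw [he]; simp
    have hsub : fl ⁻¹' {w} ⊆ (fun h => h'⁻¹ * h) ⁻¹' ball := by
      intro h hh
      simp only [Set.mem_preimage, hball, Set.mem_ofPred_eq, hDu]
      have : ∀ i, (u h i - u h' i) ^ 2 ≤ 1 / 4 ^ j := by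
        intro i
        have e : ⌊u h i * 2 ^ j⌋ = ⌊u h' i * 2 ^ j⌋ :=
          congrFun ((show fl h = w from hh).trans (show fl h' = w from hh').symm) i
        have h1 := Int.abs_sub_lt_one_of_floor_eq_floor e
        rw [← sub_mul] at h1
        have h2 : ((u h i - u h' i) * 2 ^ j) ^ 2 ≤ 1 := by
          rw [sq_le_one_iff_abs_le_one]; exact h1.le
        rw [le_div_iff₀ (by positivity)]
        calc _ = ((u h i - u h' i) * 2 ^ j) ^ 2 := by
              rw [mul_pow, ← pow_mul, mul_comm j 2, pow_mul]; norm_num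
          _ ≤ 1 := h2
      calc _ ≤ ∑ _i : ι, (1 : ℝ) / 4 ^ j := Finset.sum_le_sum fun i _ => this i
        _ = d / 4 ^ j := by simp [d]; ring
    calc μ.real (fl ⁻¹' {w}) ≤ μ.real ((fun h => h'⁻¹ * h) ⁻¹' ball) := measureReal_mono hsub
      _ = μ.real ball := by
        simp only [Measure.real]
        rw [measure_preimage_mul]
  have hcard : (cells.card : ℝ) ≤ (2 * B + 2) ^ d * (2 ^ d) ^ j := by
    simp only [cells, Fintype.card_piFinset, Int.card_Icc, Finset.prod_const, Finset.card_univ]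
    have : ((B * 2 ^ j + 1 - -(B * 2 ^ j) : ℤ)).toNat = 2 * B * 2 ^ j + 1 := by
      have : ((B * 2 ^ j + 1 - -(B * 2 ^ j) : ℤ)) = ((2 * B * 2 ^ j + 1 : ℕ) : ℤ) := by
        push_cast; ring
      rw [this, Int.toNat_natCast]
    rw [this]
    push_cast
    rw [← pow_mul, mul_comm d j, pow_mul, ← mul_pow]
    have h1 : (1 : ℝ) ≤ 2 ^ j := one_le_pow₀ (by norm_num)
    gcongr
    nlinarith
  have h1 : (1 : ℝ) ≤ cells.card * μ.real ball := by
    have : (Set.univ : Set K) = ⋃ w ∈ cells, fl ⁻¹' {w} := by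
      ext h; simp [hfl h]
    calc (1 : ℝ) = μ.real Set.univ := by simp
      _ = μ.real (⋃ w ∈ cells, fl ⁻¹' {w}) := by rw [← this]
      _ ≤ ∑ w ∈ cells, μ.real (fl ⁻¹' {w}) := measureReal_biUnion_finset_le _ _
      _ ≤ ∑ w ∈ cells, μ.real ball := Finset.sum_le_sum fun w _ => hcell w
      _ = _ := by simp
  have h2 : Real.exp (-(d / 2)) * μ.real ball ≤ ∫ h, Real.exp (-((4 : ℝ) ^ j * D h / 2)) ∂μ := by
    have hi : Integrable (fun h => Real.exp (-((4 : ℝ) ^ j * D h / 2))) μ :=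
      ps_integrable μ (by fun_prop)
    calc _ = ∫ h in ball, Real.exp (-(d / 2)) ∂μ := by simp [mul_comm]
      _ ≤ ∫ h in ball, Real.exp (-((4 : ℝ) ^ j * D h / 2)) ∂μ := by
        apply setIntegral_mono_on (by simp) hi.integrableOn hbm
        intro h hh
        simp only [hball, Set.mem_ofPred_eq] at hh
        rw [le_div_iff₀ (by positivity)] at hh
        apply Real.exp_le_exp.2
        linarith
      _ ≤ _ := setIntegral_le_integral hi (Filter.Eventually.of_forall fun h => (Real.exp_pos _).le)
  rw [div_le_iff₀ (by positivity)]
  have hb0 : 0 ≤ μ.real ball := measureReal_nonneg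
  have h3 : (1 : ℝ) ≤ ((2 * B + 2) ^ d * (2 ^ d) ^ j) * μ.real ball :=
    h1.trans (by gcongr)
  calc Real.exp (-(d / 2)) = Real.exp (-(d / 2)) * 1 := by ring
    _ ≤ Real.exp (-(d / 2)) * (((2 * B + 2) ^ d * (2 ^ d) ^ j) * μ.real ball) := by gcongr
    _ = ((2 * B + 2) ^ d * (2 ^ d) ^ j) * (Real.exp (-(d / 2)) * μ.real ball) := by ring
    _ ≤ ((2 * B + 2) ^ d * (2 ^ d) ^ j) *
        ∫ h, Real.exp (-((4 : ℝ) ^ j * D h / 2)) ∂μ := by gcongr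
    _ = _ := by ring

theorem ps_laplace (μ : Measure K) [IsProbabilityMeasure μ] [μ.IsMulLeftInvariant]
    {ι : Type} [Fintype ι] [DecidableEq ι] (u : K → ι → ℝ) (hu : ∀ i, Continuous fun h => u h i)
    (D : K → ℝ) (hD : Continuous D) (hDu : ∀ h h', D (h'⁻¹ * h) = ∑ i, (u h i - u h' i) ^ 2)
    (hD0 : ∀ h, 0 ≤ D h) (θ : K → ℝ) (hθc : Continuous θ)
    (hθ : ∀ ε > 0, ∃ r > 0, ∀ h, D h < r → |θ h| ≤ ε * D h)
    {n : ℕ} (G : K → Fin n → ℂ) (hG : Continuous G) (g0 : Fin n → ℂ)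
    (hGD : ∀ h, ‖G h - g0‖ ^ 2 ≤ D h) {κ : ℝ} (hκ : 0 < κ) {ε : ℝ} (hε : 0 < ε) :
    ∃ s M : ℝ, 0 < s ∧ 0 < M ∧ Real.exp (-(s * κ)) ≤ ε * M ∧
      ‖(∫ h, Complex.exp (s * (-(D h / 2) + θ h * Complex.I)) • G h ∂μ) - M • g0‖ ≤ ε * M := by
  obtain ⟨c, A, hc, hA, hlow⟩ := ps_lower μ u hu D hD hDu
  have hA0 : 0 < A := by linarith
  obtain ⟨R, hR⟩ := (isCompact_range hG).isBounded.exists_norm_le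
  have hR : ∀ h, ‖G h‖ ≤ |R| := fun h => (hR _ ⟨h, rfl⟩).trans (le_abs_self R)
  obtain ⟨e, he, heε⟩ : ∃ e > 0, e * ((4 * |R| + 4) * (2 * A) + 1) ≤ ε :=
    ⟨ε / ((4 * |R| + 4) * (2 * A) + 1), by positivity, by
      rw [div_mul_cancel₀]; positivity⟩
  obtain ⟨r, hr, hθr⟩ := hθ e he
  have hlim : Filter.Tendsto (fun j : ℕ => (4 : ℝ) ^ j) Filter.atTop Filter.atTop :=
    tendsto_pow_atTop_atTop_of_one_lt (by norm_num)
  have hlim2 : Filter.Tendsto (fun j : ℕ => A ^ j * Real.exp (-((4 : ℝ) ^ j * κ)))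
      Filter.atTop (nhds 0) := by
    obtain ⟨p, hp⟩ := pow_unbounded_of_one_lt A (show (1 : ℝ) < 4 by norm_num)
    have h1 := tendsto_rpow_mul_exp_neg_mul_atTop_nhds_zero p κ hκ
    have h2 := h1.comp hlim
    refine squeeze_zero (fun j => by positivity) (fun j => ?_) h2
    simp only [Function.comp, Real.rpow_natCast]
    rw [← pow_mul, mul_comm j p, pow_mul]
    have : Real.exp (-((4 : ℝ) ^ j * κ)) = Real.exp (-κ * 4 ^ j) := by congr 1; ring
    rw [this]
    gcongr
  have ev := ((hlim.eventually_ge_atTop (2 / (e * r))).and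
    ((hlim.eventually_ge_atTop (1 / e ^ 2)).and
    (hlim2.eventually_lt_const (show 0 < ε * c by positivity))))
  obtain ⟨N, hN⟩ := Filter.eventually_atTop.1 ev
  set m : ℕ → ℝ := fun j => ∫ h, Real.exp (-((4 : ℝ) ^ j * D h / 2)) ∂μ with hm
  obtain ⟨j, hj, hmj⟩ := ps_seq hc hA0 hlow N
  obtain ⟨a1, a2, a3⟩ := hN (j + 1) (by omega)
  have hlj := hlow (j + 1)
  set s : ℝ := 4 ^ (j + 1) with hs
  have hs0 : 0 < s := by positivity
  have hMpos : 0 < m (j + 1) := by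
    by_contra! hcon
    have : A ^ (j + 1) * m (j + 1) ≤ 0 := mul_nonpos_of_nonneg_of_nonpos (by positivity) hcon
    linarith
  refine ⟨s, m (j + 1), hs0, hMpos, ?_, ?_⟩
  · have h1 : A ^ (j + 1) * Real.exp (-(s * κ)) ≤ A ^ (j + 1) * (ε * m (j + 1)) := by
      calc _ ≤ ε * c := a3.le
        _ ≤ ε * (A ^ (j + 1) * m (j + 1)) := by gcongr
        _ = _ := by ring
    exact le_of_mul_le_mul_left h1 (by positivity)
  have hi1 : Integrable (fun h => Complex.exp (s * (-(D h / 2) + θ h * Complex.I)) • G h) μ :=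
    ps_integrable μ (by fun_prop)
  have hi2 : ∀ j : ℕ, Integrable (fun h => Real.exp (-((4 : ℝ) ^ j * D h / 2))) μ :=
    fun j => ps_integrable μ (by fun_prop)
  have e1 : m (j + 1) • g0 = ∫ h, Real.exp (-(s * D h / 2)) • g0 ∂μ := by
    rw [integral_smul_const]
  rw [e1, ← integral_sub hi1 ((hi2 _).smul_const g0)]
  have hpt : ∀ h, ‖Complex.exp (s * (-(D h / 2) + θ h * Complex.I)) • G h
      - Real.exp (-(s * D h / 2)) • g0‖ ≤ e * ((4 * |R| + 4) * Real.exp (-((4 : ℝ) ^ j * D h / 2))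
        + Real.exp (-(s * D h / 2))) := by
    intro h
    set t := s * D h / 2 with ht
    have ht0 : 0 ≤ t := by have := hD0 h; positivity
    have b1 : Complex.exp (s * (-(D h / 2) + θ h * Complex.I)) =
        (Real.exp (-t) : ℂ) * Complex.exp (Complex.I * ((s * θ h : ℝ) : ℂ)) := by
      rw [Complex.ofReal_exp, ← Complex.exp_add]; congr 1; push_cast [ht]; ring
    have b2 : Complex.exp (s * (-(D h / 2) + θ h * Complex.I)) • G h - Real.exp (-t) • g0
        = (Real.exp (-t) : ℂ) • ((Complex.exp (Complex.I * ((s * θ h : ℝ) : ℂ)) - 1) • G h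
          + (G h - g0)) := by
      rw [b1]
      ext i
      simp
      ring
    have b3 : ‖Complex.exp (Complex.I * ((s * θ h : ℝ) : ℂ)) - 1‖ ≤ 2 * e * t := by
      by_cases hDr : D h < r
      · have := Real.norm_exp_I_mul_ofReal_sub_one_le (x := s * θ h)
        refine this.trans ?_
        rw [Real.norm_eq_abs, abs_mul, abs_of_pos hs0]
        have := hθr h hDr
        calc s * |θ h| ≤ s * (e * D h) := by gcongr
          _ = 2 * e * t := by rw [ht]; ring
      · push Not at hDr
        rw [div_le_iff₀ (by positivity)] at a1
        calc _ ≤ ‖Complex.exp (Complex.I * ((s * θ h : ℝ) : ℂ))‖ + ‖(1 : ℂ)‖ := norm_sub_le _ _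
          _ = 2 := by rw [mul_comm, Complex.norm_exp_ofReal_mul_I]; norm_num
          _ ≤ s * (e * r) := a1
          _ ≤ s * (e * D h) := by gcongr
          _ = _ := by rw [ht]; ring
    have b4 : ‖G h - g0‖ ≤ e + 2 * e * t := by
      have h1 := hGD h
      rw [div_le_iff₀ (by positivity)] at a2
      have h2 : D h ≤ 2 * e ^ 2 * t := by
        calc D h = 1 * D h := by ring
          _ ≤ (s * e ^ 2) * D h := by have := hD0 h; gcongr
          _ = _ := by rw [ht]; ring
      apply le_of_sq_le_sq _ (by positivity)
      have h3 : 0 ≤ e ^ 2 * t := by positivity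
      have h4 : 0 ≤ (e * t) ^ 2 := by positivity
      nlinarith
    have b5 : t * Real.exp (-t) ≤ 2 * Real.exp (-((4 : ℝ) ^ j * D h / 2)) := by
      have h1 : t / 2 ≤ Real.exp (t / 2) := by
        have := Real.add_one_le_exp (t / 2); linarith
      have h2 : Real.exp (-t) * Real.exp (t / 2) ≤ Real.exp (-((4 : ℝ) ^ j * D h / 2)) := by
        rw [← Real.exp_add]
        apply Real.exp_le_exp.2
        have : t = 4 * (4 ^ j * D h / 2) := by rw [ht, hs, pow_succ]; ring
        linarith
      calc t * Real.exp (-t) = 2 * (Real.exp (-t) * (t / 2)) := by ring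
        _ ≤ 2 * (Real.exp (-t) * Real.exp (t / 2)) := by gcongr
        _ ≤ _ := by gcongr
    rw [b2, norm_smul]
    have b6 : ‖(Real.exp (-t) : ℂ)‖ = Real.exp (-t) := by
      rw [Complex.norm_real, Real.norm_eq_abs, abs_of_pos (Real.exp_pos _)]
    rw [b6]
    calc Real.exp (-t) * ‖(Complex.exp (Complex.I * ((s * θ h : ℝ) : ℂ)) - 1) • G h + (G h - g0)‖
        ≤ Real.exp (-t) * (2 * e * t * |R| + (e + 2 * e * t)) := by
          gcongr
          refine (norm_add_le _ _).trans ?_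
          rw [norm_smul]
          gcongr
          exact hR h
      _ = e * ((2 * |R| + 2) * (t * Real.exp (-t)) + Real.exp (-t)) := by ring
      _ ≤ e * ((2 * |R| + 2) * (2 * Real.exp (-((4 : ℝ) ^ j * D h / 2))) + Real.exp (-t)) := by
          gcongr
      _ = _ := by ring
  have hi3 : Integrable (fun h => (4 * |R| + 4) * Real.exp (-((4 : ℝ) ^ j * D h / 2))
        + Real.exp (-(s * D h / 2))) μ := ((hi2 j).const_mul _).add (hi2 (j + 1))
  calc _ ≤ ∫ h, e * ((4 * |R| + 4) * Real.exp (-((4 : ℝ) ^ j * D h / 2))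
        + Real.exp (-(s * D h / 2))) ∂μ :=
        norm_integral_le_of_norm_le (hi3.const_mul e) (Filter.Eventually.of_forall hpt)
    _ = e * ((4 * |R| + 4) * m j + m (j + 1)) := by
        rw [integral_const_mul, integral_add ((hi2 j).const_mul _) (hi2 (j + 1)),
          integral_const_mul]
    _ ≤ e * ((4 * |R| + 4) * (2 * A * m (j + 1)) + m (j + 1)) := by gcongr
    _ = (e * ((4 * |R| + 4) * (2 * A) + 1)) * m (j + 1) := by ring
    _ ≤ ε * m (j + 1) := by gcongr
end laplace

theorem ps_act_mul {n : ℕ} (M N : Matrix (Fin n) (Fin n) ℝ) (y : Fin n → ℂ) :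
    psAct (M * N) y = psAct M (psAct N y) := by
  simp only [ps_psAct_eq, Matrix.mulVec_mulVec]
  congr 1
  ext i j
  simp [Matrix.mul_apply]

theorem ps_act_one {n : ℕ} (y : Fin n → ℂ) : psAct 1 y = y := by
  ext i
  simp [psAct, Matrix.one_apply, apply_ite Complex.ofReal]

theorem ps_act_sub {n : ℕ} (M : Matrix (Fin n) (Fin n) ℝ) (y w : Fin n → ℂ) :
    psAct M (y - w) = psAct M y - psAct M w := by
  simp only [ps_psAct_eq, Matrix.mulVec_sub]

theorem ps_act_star {n : ℕ} (M : Matrix (Fin n) (Fin n) ℝ) (y : Fin n → ℂ) :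
    psAct M (star y) = star (psAct M y) := by
  ext i
  simp [psAct]

theorem ps_act_dot {n : ℕ} (M : Matrix (Fin n) (Fin n) ℝ) (y w : Fin n → ℂ) :
    y ⬝ᵥ psAct M w = psAct Mᵀ y ⬝ᵥ w := by
  simp only [ps_psAct_eq, Matrix.dotProduct_mulVec, ← Matrix.mulVec_transpose]
  rfl

theorem ps_act_norm {n : ℕ} {M : Matrix (Fin n) (Fin n) ℝ} (hM : Mᵀ * M = 1) (y : Fin n → ℂ) :
    ∑ i, ‖psAct M y i‖ ^ 2 = ∑ i, ‖y i‖ ^ 2 := by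
  rw [ps_psAct_eq]
  apply ps_normsq_mulVec
  have : (M.map Complex.ofReal)ᴴ * M.map Complex.ofReal = (Mᵀ * M).map Complex.ofReal := by
    ext i j
    simp [Matrix.mul_apply]
  rw [this, hM]
  ext i j
  simp [Matrix.one_apply]
  split_ifs <;> simp

section grp
variable {n m : ℕ} {K : Type} [Group K] [TopologicalSpace K] [IsTopologicalGroup K] [CompactSpace K]

theorem ps_act_cont {ρ : K →* Matrix (Fin n) (Fin n) ℝ} (hρ : Continuous ρ) (x : Fin n → ℂ) :
    Continuous fun h => psAct (ρ h) x := by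
  unfold psAct
  have : ∀ i j, Continuous fun h => ρ h i j := fun i j => by
    have := (continuous_id.matrix_elem i j).comp hρ
    exact this
  fun_prop

theorem ps_act_inj {ρ : K →* Matrix (Fin n) (Fin n) ℝ} {h : K} {y w : Fin n → ℂ}
    (e : psAct (ρ h) y = w) : psAct (ρ h⁻¹) w = y := by
  rw [← e, ← ps_act_mul, ← map_mul, inv_mul_cancel, map_one, ps_act_one]

theorem ps_theta (ρ : K →* Matrix (Fin n) (Fin n) ℝ) (hρ : Continuous ρ)
    (hO : ∀ h, (ρ h)ᵀ * ρ h = 1) (π : Fin m → MvPolynomial (Fin n) ℝ)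
    (hinv : ∀ h i, polyAct (ρ h) (π i) = π i) (z : Fin m → ℝ) (x : Fin n → ℂ)
    (hx : ∀ i, aeval x (π i) = (z i : ℂ))
    (hmin : ∀ y : Fin n → ℂ, (∀ i, aeval y (π i) = (z i : ℂ)) → ∑ i, ‖x i‖ ^ 2 ≤ ∑ i, ‖y i‖ ^ 2)
    {ε : ℝ} (hε : 0 < ε) :
    ∃ r > 0, ∀ h, ∑ i, ‖(psAct (ρ h) x - x) i‖ ^ 2 < r →
      |(star x ⬝ᵥ psAct (ρ h) x).im| ≤ ε * ∑ i, ‖(psAct (ρ h) x - x) i‖ ^ 2 := by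
  obtain ⟨η, hη, hnear⟩ := ps_near1 π z x hmin hε
  have hent : ∀ i j, Continuous fun h => ρ h i j := fun i j =>
    (continuous_id.matrix_elem i j).comp hρ
  set N : Set K := {h | ∀ i j, |ρ h i j - (1 : Matrix (Fin n) (Fin n) ℝ) i j| < η} with hN
  have hNo : IsOpen N := by
    have : N = ⋂ i, ⋂ j, {h | |ρ h i j - (1 : Matrix (Fin n) (Fin n) ℝ) i j| < η} := by
      ext; simp [hN]
    rw [this]
    refine isOpen_iInter_of_finite fun i => isOpen_iInter_of_finite fun j => ?_
    exact isOpen_lt ((hent i j).sub continuous_const).abs continuous_const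
  set U : Set K := ⋃ k ∈ {k : K | psAct (ρ k) x = x}, (fun h => h * k) ⁻¹' N with hU
  have hUo : IsOpen U := isOpen_biUnion fun k _ => hNo.preimage (continuous_mul_const k)
  have hCc : IsCompact Uᶜ := hUo.isClosed_compl.isCompact
  have hDc : Continuous fun h => ∑ i, ‖(psAct (ρ h) x - x) i‖ ^ 2 := by
    have := ps_act_cont hρ x
    have h2 : ∀ i, Continuous fun h => psAct (ρ h) x i := fun i => (continuous_apply i).comp this
    simp only [Pi.sub_apply]
    fun_prop
  have hpos : ∀ h ∈ Uᶜ, 0 < ∑ i, ‖(psAct (ρ h) x - x) i‖ ^ 2 := by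
    intro h hh
    by_contra! hcon
    have h0 : ∑ i, ‖(psAct (ρ h) x - x) i‖ ^ 2 = 0 :=
      le_antisymm hcon (Finset.sum_nonneg fun i _ => by positivity)
    rw [Finset.sum_eq_zero_iff_of_nonneg (fun i _ => by positivity)] at h0
    have hx0 : psAct (ρ h) x = x := by
      ext i
      have := h0 i (Finset.mem_univ i)
      simpa [sub_eq_zero] using this
    apply hh
    simp only [hU, Set.mem_iUnion]
    refine ⟨h⁻¹, ps_act_inj hx0, ?_⟩
    simp only [hN, Set.mem_preimage, Set.mem_ofPred_eq, mul_inv_cancel, map_one, sub_self, abs_zero]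
    exact fun _ _ => hη
  have hU2 : ∀ h ∈ U, |(star x ⬝ᵥ psAct (ρ h) x).im| ≤ ε * ∑ i, ‖(psAct (ρ h) x - x) i‖ ^ 2 := by
    intro h hh
    simp only [hU, Set.mem_iUnion] at hh
    obtain ⟨k, hk, hhk⟩ := hh
    have e : psAct (ρ (h * k)) x = psAct (ρ h) x := by
      rw [map_mul, ps_act_mul]; rw [show psAct (ρ k) x = x from hk]
    have := hnear (ρ (h * k)) (hO _) (fun i j => (hhk i j).le) (fun p i => by
      rw [← map_pow, ← ps_aeval_polyAct, hinv, hx])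
    rwa [e] at this
  rcases (Uᶜ).eq_empty_or_nonempty with he | hne
  · refine ⟨1, one_pos, fun h _ => hU2 h ?_⟩
    rw [Set.compl_empty_iff] at he
    rw [he]; trivial
  · obtain ⟨h0, hh0, hm⟩ := hCc.exists_isMinOn hne hDc.continuousOn
    refine ⟨_, hpos h0 hh0, fun h hh => hU2 h ?_⟩
    by_contra hc
    exact absurd (hm (show h ∈ Uᶜ from hc)) (not_le.2 hh)

end grp

theorem ps_AB {n : ℕ} (x : Fin n → ℂ) (k : ℕ) :
    ∃ A B : MvPolynomial (Fin n) ℝ, ∀ y : Fin n → ℂ,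
      aeval y A + Complex.I * aeval y B = (x ⬝ᵥ y) ^ k ∧
      aeval y A - Complex.I * aeval y B = (star x ⬝ᵥ y) ^ k ∧
      ∀ j, aeval y (pderiv j A) + Complex.I * aeval y (pderiv j B)
          = k * (x ⬝ᵥ y) ^ (k - 1) * x j ∧
        aeval y (pderiv j A) - Complex.I * aeval y (pderiv j B)
          = k * (star x ⬝ᵥ y) ^ (k - 1) * star x j := by
  induction k with
  | zero => exact ⟨1, 0, fun y => by simp⟩
  | succ k ih =>
    obtain ⟨A, B, h⟩ := ih
    set l : MvPolynomial (Fin n) ℝ := ∑ i, C (x i).re * X i with hl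
    set q : MvPolynomial (Fin n) ℝ := ∑ i, C (x i).im * X i with hq
    have dl : ∀ j, pderiv j l = C (x j).re := by
      intro j
      rw [hl, map_sum, Finset.sum_eq_single j]
      · simp
      · intro b _ hb; simp [pderiv_X, hb]
      · simp
    have dq : ∀ j, pderiv j q = C (x j).im := by
      intro j
      rw [hq, map_sum, Finset.sum_eq_single j]
      · simp
      · intro b _ hb; simp [pderiv_X, hb]
      · simp
    have x1 : ∀ j, ((x j).re : ℂ) + Complex.I * (x j).im = x j := by
      intro j; apply Complex.ext <;> simp
    have x2 : ∀ j, ((x j).re : ℂ) - Complex.I * (x j).im = star x j := by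
      intro j; apply Complex.ext <;> simp
    have e1 : ∀ y : Fin n → ℂ, aeval y l + Complex.I * aeval y q = x ⬝ᵥ y := by
      intro y
      simp only [hl, hq, map_sum, map_mul, aeval_X, aeval_C, dotProduct, Finset.mul_sum,
        ← Finset.sum_add_distrib]
      refine Finset.sum_congr rfl fun i _ => ?_
      simp only [Complex.coe_algebraMap]
      linear_combination (y i) * x1 i
    have e2 : ∀ y : Fin n → ℂ, aeval y l - Complex.I * aeval y q = star x ⬝ᵥ y := by
      intro y
      simp only [hl, hq, map_sum, map_mul, aeval_X, aeval_C, dotProduct, Finset.mul_sum,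
        ← Finset.sum_sub_distrib]
      refine Finset.sum_congr rfl fun i _ => ?_
      have : star x i = (x i).re - (x i).im * Complex.I := by
        apply Complex.ext <;> simp
      rw [this]
      simp
      ring
    have I2 : Complex.I ^ 2 = -1 := Complex.I_sq
    have hk : ∀ w : ℂ, w * (k * w ^ (k - 1)) = k * w ^ k := by
      intro w
      cases k with
      | zero => simp
      | succ k => simp only [Nat.add_sub_cancel]; ring
    refine ⟨l * A - q * B, l * B + q * A, fun y => ?_⟩
    obtain ⟨h1, h2, h3⟩ := h y
    refine ⟨?_, ?_, fun j => ⟨?_, ?_⟩⟩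
    · rw [pow_succ, ← h1, ← e1 y]
      simp only [map_sub, map_add, map_mul]
      linear_combination (-(aeval y q * aeval y B)) * I2
    · rw [pow_succ, ← h2, ← e2 y]
      simp only [map_sub, map_add, map_mul]
      linear_combination (-(aeval y q * aeval y B)) * I2
    · have h4 := (h3 j).1
      simp only [Derivation.leibniz, map_sub, map_add, map_mul, dl, dq, smul_eq_mul, aeval_C,
        Complex.coe_algebraMap, Nat.add_sub_cancel, Nat.cast_succ]
      have : ((k : ℂ) + 1) * (x ⬝ᵥ y) ^ k * x j = (x ⬝ᵥ y) * (k * (x ⬝ᵥ y) ^ (k - 1) * x j)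
          + (x ⬝ᵥ y) ^ k * x j := by
        linear_combination (-(x j)) * hk (x ⬝ᵥ y)
      rw [this, ← h4, ← h1, ← e1 y]
      conv_rhs => rw [← x1 j]
      linear_combination (-(aeval y q * aeval y (pderiv j B)) - aeval y B * (x j).im) * I2
    · have h4 := (h3 j).2
      simp only [Derivation.leibniz, map_sub, map_add, map_mul, dl, dq, smul_eq_mul, aeval_C,
        Complex.coe_algebraMap, Nat.add_sub_cancel, Nat.cast_succ]
      have : ((k : ℂ) + 1) * (star x ⬝ᵥ y) ^ k * star x j =
          (star x ⬝ᵥ y) * (k * (star x ⬝ᵥ y) ^ (k - 1) * star x j)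
          + (star x ⬝ᵥ y) ^ k * star x j := by
        linear_combination (-(star x j)) * hk (star x ⬝ᵥ y)
      rw [this, ← h4, ← h2, ← e2 y, ← x2 j]
      linear_combination (-(aeval y q * aeval y (pderiv j B)) - aeval y B * (x j).im) * I2

/-- gradients at `x` of invariant polynomials -/
noncomputable def psV {n : ℕ} {K : Type} [Group K] (ρ : K →* Matrix (Fin n) (Fin n) ℝ)
    (x : Fin n → ℂ) : Submodule ℝ (Fin n → ℂ) where
  carrier := {v | ∃ p : MvPolynomial (Fin n) ℝ, (∀ g, polyAct (ρ g) p = p) ∧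
    ∀ j, v j = aeval x (pderiv j p)}
  add_mem' := by
    rintro v w ⟨p, hp, hv⟩ ⟨q, hq, hw⟩
    exact ⟨p + q, fun g => by rw [map_add, hp, hq], fun j => by simp [hv, hw]⟩
  zero_mem' := ⟨0, by simp, by simp⟩
  smul_mem' := by
    rintro c v ⟨p, hp, hv⟩
    exact ⟨c • p, fun g => by rw [map_smul, hp], fun j => by simp [hv]⟩

section grp2
variable {n : ℕ} {K : Type} [Group K] [TopologicalSpace K] [IsTopologicalGroup K] [CompactSpace K]
    [MeasurableSpace K] [BorelSpace K]

/-- the two kernels -/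
noncomputable def psKer (ρ : K →* Matrix (Fin n) (Fin n) ℝ) (x v : Fin n → ℂ) (φ : ℂ → ℂ) (h : K) :
    Fin n → ℂ := φ (v ⬝ᵥ psAct (ρ h) x) • psAct (ρ h)ᵀ v

theorem ps_ker_cont {ρ : K →* Matrix (Fin n) (Fin n) ℝ} (hρ : Continuous ρ) (x v : Fin n → ℂ)
    {φ : ℂ → ℂ} (hφ : Continuous φ) : Continuous (psKer ρ x v φ) := by
  unfold psKer
  have h1 := ps_act_cont hρ x
  have h2 : Continuous fun h => psAct (ρ h)ᵀ v := by
    have : ∀ i j, Continuous fun h => ρ h i j := fun i j =>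
      (continuous_id.matrix_elem i j).comp hρ
    unfold psAct
    simp only [Matrix.transpose_apply]
    fun_prop
  have h3 : Continuous fun h => v ⬝ᵥ psAct (ρ h) x := continuous_const.dotProduct h1
  exact (hφ.comp h3).smul h2

theorem ps_pow_mem (μ : Measure K) [IsProbabilityMeasure μ] [μ.IsMulLeftInvariant]
    [μ.IsMulRightInvariant] (ρ : K →* Matrix (Fin n) (Fin n) ℝ) (hρ : Continuous ρ)
    (x : Fin n → ℂ) (k : ℕ) :
    ∫ h, (psKer ρ x (star x) (fun w => w ^ k) h + psKer ρ x x (fun w => w ^ k) h) ∂μ ∈ psV ρ x := by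
  obtain ⟨A, B, hAB⟩ := ps_AB x (k + 1)
  obtain ⟨p, hp, hT⟩ := ps_avg μ ρ hρ ((2 / ((k : ℝ) + 1)) • A)
  refine ⟨p, hp, fun j => ?_⟩
  have hc : ∀ v, Continuous (psKer ρ x v (fun w => w ^ k)) := fun v =>
    ps_ker_cont hρ x v (by fun_prop)
  have h1 := hT ((aeval x : MvPolynomial (Fin n) ℝ →ₐ[ℝ] ℂ).toLinearMap ∘ₗ
    (pderiv j : Derivation ℝ (MvPolynomial (Fin n) ℝ) (MvPolynomial (Fin n) ℝ)).toLinearMap)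
  simp only [LinearMap.comp_apply, AlgHom.toLinearMap_apply] at h1
  have h2 : aeval x (pderiv j p) = ∫ h, aeval x (pderiv j (polyAct (ρ h) ((2 / ((k : ℝ) + 1)) • A))) ∂μ :=
    h1
  rw [h2, eval_integral]
  · refine integral_congr_ae (Filter.Eventually.of_forall fun h => ?_)
    beta_reduce
    rw [ps_pderiv_polyAct]
    simp only [map_sum, map_smul, Derivation.map_smul, ps_aeval_polyAct, psKer]
    have h3 : ∀ i, aeval (psAct (ρ h) x) (pderiv i A) = ((k : ℂ) + 1) / 2 *
        ((star x ⬝ᵥ psAct (ρ h) x) ^ k * star x i + (x ⬝ᵥ psAct (ρ h) x) ^ k * x i) := by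
      intro i
      obtain ⟨-, -, h4⟩ := hAB (psAct (ρ h) x)
      obtain ⟨h5, h6⟩ := h4 i
      simp only [Nat.add_sub_cancel, Nat.cast_succ] at h5 h6
      linear_combination (1 / 2) * h5 + (1 / 2) * h6
    simp only [h3, Pi.add_apply, Pi.smul_apply, smul_eq_mul, psAct, Finset.mul_sum,
      ← Finset.sum_add_distrib]
    refine Finset.sum_congr rfl fun i _ => ?_
    have : ((k : ℂ) + 1) ≠ 0 := by exact_mod_cast k.succ_ne_zero
    simp only [Complex.real_smul, Matrix.transpose_apply]
    push_cast
    field_simp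
  · intro i
    exact ps_integrable μ ((continuous_apply i).comp ((hc _).add (hc _)))

theorem ps_exp_mem (μ : Measure K) [IsProbabilityMeasure μ] [μ.IsMulLeftInvariant]
    [μ.IsMulRightInvariant] (ρ : K →* Matrix (Fin n) (Fin n) ℝ) (hρ : Continuous ρ)
    (x : Fin n → ℂ) (s : ℝ) :
    ∫ h, (psKer ρ x (star x) (fun w => Complex.exp (s * w)) h
      + psKer ρ x x (fun w => Complex.exp (s * w)) h) ∂μ ∈ psV ρ x := by
  have hcl : IsClosed (psV ρ x : Set (Fin n → ℂ)) := Submodule.closed_of_finiteDimensional _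
  let f : ℕ → K → Fin n → ℂ := fun k h => psKer ρ x (star x) (fun w => w ^ k) h
      + psKer ρ x x (fun w => w ^ k) h
  have hc : ∀ v k, Continuous (psKer ρ x v (fun w => w ^ k)) := fun v k =>
    ps_ker_cont hρ x v (by fun_prop)
  have hfc : ∀ k, Continuous (f k) := fun k => (hc _ k).add (hc _ k)
  let F : ℕ → K → Fin n → ℂ := fun k h => (s ^ k / (k.factorial : ℝ)) • f k h
  have hFc : ∀ k, Continuous (F k) := fun k => (hfc k).fun_const_smul _
  have hb : ∀ v : Fin n → ℂ, ∃ R : ℝ, 0 ≤ R ∧ ∀ h, ‖v ⬝ᵥ psAct (ρ h) x‖ ≤ R ∧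
      ‖psAct (ρ h)ᵀ v‖ ≤ R := by
    intro v
    have h1 : Continuous fun h => v ⬝ᵥ psAct (ρ h) x :=
      continuous_const.dotProduct (ps_act_cont hρ x)
    have h2 : Continuous fun h => psAct (ρ h)ᵀ v := by
      have e : psKer ρ x v (fun _ => 1) = fun h => psAct (ρ h)ᵀ v := by
        funext h; simp [psKer]
      rw [← e]
      exact ps_ker_cont hρ x v continuous_const
    obtain ⟨R1, hR1⟩ := (isCompact_range h1).isBounded.exists_norm_le
    obtain ⟨R2, hR2⟩ := (isCompact_range h2).isBounded.exists_norm_le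
    refine ⟨max 0 (max R1 R2), le_max_left _ _, fun h => ⟨?_, ?_⟩⟩
    · exact (hR1 _ ⟨h, rfl⟩).trans ((le_max_left _ _).trans (le_max_right _ _))
    · exact (hR2 _ ⟨h, rfl⟩).trans ((le_max_right _ _).trans (le_max_right _ _))
  obtain ⟨R, hR0, hR⟩ := hb (star x)
  obtain ⟨R', hR0', hR'⟩ := hb x
  have hbound : ∀ k h, ‖F k h‖ ≤ (|s| * R) ^ k / k.factorial * R
      + (|s| * R') ^ k / k.factorial * R' := by
    intro k h
    have h1 : ‖f k h‖ ≤ R ^ k * R + R' ^ k * R' := by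
      refine (norm_add_le _ _).trans ?_
      simp only [psKer, norm_smul, norm_pow]
      have a := hR h
      have b := hR' h
      gcongr
      · exact a.1
      · exact a.2
      · exact b.1
      · exact b.2
    calc ‖F k h‖ = |s| ^ k / k.factorial * ‖f k h‖ := by
          simp only [F, norm_smul, norm_div, norm_pow, Real.norm_eq_abs, Nat.abs_cast]
      _ ≤ |s| ^ k / k.factorial * (R ^ k * R + R' ^ k * R') := by gcongr
      _ = _ := by rw [mul_pow, mul_pow]; ring
  have hsum : Summable fun k : ℕ => (|s| * R) ^ k / k.factorial * R
      + (|s| * R') ^ k / k.factorial * R' :=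
    ((Real.summable_pow_div_factorial _).mul_right _).add
      ((Real.summable_pow_div_factorial _).mul_right _)
  have key := hasSum_integral_of_dominated_convergence (μ := μ) (F := F)
    (f := fun h => psKer ρ x (star x) (fun w => Complex.exp (s * w)) h
      + psKer ρ x x (fun w => Complex.exp (s * w)) h)
    (fun k _ => (|s| * R) ^ k / k.factorial * R + (|s| * R') ^ k / k.factorial * R')
    (fun k => (hFc k).aestronglyMeasurable)
    (fun k => Filter.Eventually.of_forall (hbound k))
    (Filter.Eventually.of_forall fun h => hsum) (integrable_const _)
    (Filter.Eventually.of_forall fun h => by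
      have h1 : ∀ v, HasSum (fun k : ℕ => (s ^ k / (k.factorial : ℝ)) • psKer ρ x v (fun w => w ^ k) h)
          (psKer ρ x v (fun w => Complex.exp (s * w)) h) := by
        intro v
        have h2 := NormedSpace.expSeries_div_hasSum_exp (s * (v ⬝ᵥ psAct (ρ h) x) : ℂ)
        rw [← Complex.exp_eq_exp_ℂ] at h2
        have h3 := h2.smul_const (psAct (ρ h)ᵀ v)
        convert! h3 using 2 with k
        ext i
        simp only [psKer, Pi.smul_apply, smul_eq_mul, Complex.real_smul]
        push_cast
        rw [mul_pow]
        ring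
      have := (h1 (star x)).add (h1 x)
      simpa only [F, f, smul_add] using this)
  refine hcl.mem_of_tendsto key (Filter.Eventually.of_forall fun t => ?_)
  refine Submodule.sum_mem _ fun k _ => ?_
  simp only [F]
  rw [integral_smul]
  exact Submodule.smul_mem _ _ (ps_pow_mem μ ρ hρ x k)

end grp2

theorem ps_expand {n : ℕ} (v w : Fin n → ℂ) :
    ∑ i, ‖(w - v) i‖ ^ 2 = ∑ i, ‖w i‖ ^ 2 + ∑ i, ‖v i‖ ^ 2 - 2 * (star v ⬝ᵥ w).re := by
  simp only [dotProduct, Complex.re_sum, Finset.mul_sum, ← Finset.sum_add_distrib,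
    ← Finset.sum_sub_distrib]
  refine Finset.sum_congr rfl fun i _ => ?_
  simp only [Pi.sub_apply, ← Complex.normSq_eq_norm_sq, Complex.normSq_apply, Complex.mul_re,
    Complex.sub_re, Complex.sub_im]
  simp
  ring

theorem ps_sup_le {n : ℕ} (v : Fin n → ℂ) : ‖v‖ ^ 2 ≤ ∑ i, ‖v i‖ ^ 2 := by
  have h0 : 0 ≤ ∑ i, ‖v i‖ ^ 2 := Finset.sum_nonneg fun i _ => by positivity
  have h1 : ‖v‖ ≤ √(∑ i, ‖v i‖ ^ 2) := by
    rw [pi_norm_le_iff_of_nonneg (Real.sqrt_nonneg _)]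
    intro i
    apply Real.le_sqrt_of_sq_le
    exact Finset.single_le_sum (f := fun i => ‖v i‖ ^ 2) (fun _ _ => by positivity)
      (Finset.mem_univ i)
  exact (Real.le_sqrt (norm_nonneg _) h0).1 h1

section grp3
variable {n m : ℕ} {K : Type} [Group K] [TopologicalSpace K] [IsTopologicalGroup K] [CompactSpace K]
    [MeasurableSpace K] [BorelSpace K]

theorem ps_star_mem (μ : Measure K) [IsProbabilityMeasure μ] [μ.IsMulLeftInvariant]
    [μ.IsMulRightInvariant] (ρ : K →* Matrix (Fin n) (Fin n) ℝ) (hρ : Continuous ρ)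
    (hO : ∀ h, (ρ h)ᵀ * ρ h = 1) (x : Fin n → ℂ)
    (hθ : ∀ ε > 0, ∃ r > 0, ∀ h, ∑ i, ‖(psAct (ρ h) x - x) i‖ ^ 2 < r →
      |(star x ⬝ᵥ psAct (ρ h) x).im| ≤ ε * ∑ i, ‖(psAct (ρ h) x - x) i‖ ^ 2) :
    star x ∈ psV ρ x := by
  have hcl : IsClosed (psV ρ x : Set (Fin n → ℂ)) := Submodule.closed_of_finiteDimensional _
  have hinvT : ∀ h, ρ h⁻¹ = (ρ h)ᵀ := by
    intro h
    have h1 : ρ h * ρ h⁻¹ = 1 := by rw [← map_mul, mul_inv_cancel, map_one]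
    calc ρ h⁻¹ = (ρ h)ᵀ * ρ h * ρ h⁻¹ := by rw [hO, one_mul]
      _ = _ := by rw [mul_assoc, h1, mul_one]
  have hac := ps_act_cont hρ x
  have haci : ∀ i, Continuous fun h => psAct (ρ h) x i := fun i => (continuous_apply i).comp hac
  have hDc : Continuous fun h => ∑ i, ‖(psAct (ρ h) x - x) i‖ ^ 2 := by
    simp only [Pi.sub_apply]; fun_prop
  set D : K → ℝ := fun h => ∑ i, ‖(psAct (ρ h) x - x) i‖ ^ 2 with hD
  set θ : K → ℝ := fun h => (star x ⬝ᵥ psAct (ρ h) x).im with hθd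
  have hθc : Continuous θ := Complex.continuous_im.comp (continuous_const.dotProduct hac)
  set nx : ℝ := ∑ i, ‖x i‖ ^ 2 with hnx
  have hnorm : ∀ h, ∑ i, ‖psAct (ρ h) x i‖ ^ 2 = nx := fun h => ps_act_norm (hO h) x
  set u : K → Fin n ⊕ Fin n → ℝ := fun h => Sum.elim (fun i => (psAct (ρ h) x i).re)
    (fun i => (psAct (ρ h) x i).im) with hu
  have huc : ∀ i, Continuous fun h => u h i := by
    rintro (i | i)
    · exact Complex.continuous_re.comp (haci i)
    · exact Complex.continuous_im.comp (haci i)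
  have hDu : ∀ h h', D (h'⁻¹ * h) = ∑ i, (u h i - u h' i) ^ 2 := by
    intro h h'
    have e1 : psAct (ρ h') (psAct (ρ (h'⁻¹ * h)) x - x) = psAct (ρ h) x - psAct (ρ h') x := by
      rw [ps_act_sub, ← ps_act_mul, ← map_mul, mul_inv_cancel_left]
    simp only [hD]
    rw [← ps_act_norm (hO h'), e1, Fintype.sum_sum_type, ← Finset.sum_add_distrib]
    refine Finset.sum_congr rfl fun i _ => ?_
    simp only [hu, Sum.elim_inl, Sum.elim_inr, Pi.sub_apply, ← Complex.normSq_eq_norm_sq,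
      Complex.normSq_apply, Complex.sub_re, Complex.sub_im]
    ring
  have hD0 : ∀ h, 0 ≤ D h := fun h => Finset.sum_nonneg fun i _ => by positivity
  have hGc : ∀ v : Fin n → ℂ, Continuous fun h => psAct (ρ h)ᵀ v := by
    intro v
    have := (ps_act_cont hρ v).comp continuous_inv
    simpa only [Function.comp_def, hinvT] using this
  have hGD : ∀ h, ‖psAct (ρ h)ᵀ (star x) - star x‖ ^ 2 ≤ D h := by
    intro h
    refine (ps_sup_le _).trans (le_of_eq ?_)
    rw [← ps_act_norm (hO h), ps_act_sub, ← ps_act_mul, ← hinvT, ← map_mul, mul_inv_cancel, map_one,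
      ps_act_one, ps_act_star, ← star_sub]
    simp only [hD]
    refine Finset.sum_congr rfl fun i _ => ?_
    rw [Pi.star_apply, norm_star, ← norm_neg, ← Pi.neg_apply, neg_sub]
  have hψ : ∀ h, star x ⬝ᵥ psAct (ρ h) x = nx + (-(D h / 2) + θ h * Complex.I) := by
    intro h
    have h1 : D h = 2 * nx - 2 * (star x ⬝ᵥ psAct (ρ h) x).re := by
      simp only [hD]; rw [ps_expand, hnorm h]; ring
    apply Complex.ext
    · simp [h1]
      ring
    · simp [hθd]
  -- the two integrands
  have hk : ∀ (s : ℝ) (v : Fin n → ℂ),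
      Continuous (psKer ρ x v (fun w => Complex.exp (s * w))) := fun s v =>
    ps_ker_cont hρ x v (by fun_prop)
  have hfirst : ∀ s : ℝ, ∫ h, psKer ρ x (star x) (fun w => Complex.exp (s * w)) h ∂μ
      = Real.exp (s * nx) • ∫ h, Complex.exp (s * (-(D h / 2) + θ h * Complex.I)) •
        psAct (ρ h)ᵀ (star x) ∂μ := by
    intro s
    rw [← integral_smul]
    refine integral_congr_ae (Filter.Eventually.of_forall fun h => ?_)
    simp only [psKer, hψ]
    rw [mul_add, Complex.exp_add]
    ext i
    simp
    ring
  have hInteg : ∀ (s : ℝ) (v : Fin n → ℂ),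
      Integrable (psKer ρ x v (fun w => Complex.exp (s * w))) μ := fun s v =>
    ps_integrable μ (hk s v)
  rw [← SetLike.mem_coe, ← hcl.closure_eq, Metric.mem_closure_iff]
  intro e he
  by_cases hcase : ∃ k, psAct (ρ k) x = star x
  · obtain ⟨k, hkx⟩ := hcase
    obtain ⟨s, M, hs, hM, -, hest⟩ := ps_laplace μ u huc D hDc hDu hD0 θ hθc hθ
      (fun h => psAct (ρ h)ᵀ (star x)) (hGc _) (star x) hGD one_pos (half_pos he)
    have hmem := ps_exp_mem μ ρ hρ x s
    rw [integral_add (hInteg _ _) (hInteg _ _)] at hmem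
    have hsec : ∫ h, psKer ρ x x (fun w => Complex.exp (s * w)) h ∂μ
        = ∫ h, psKer ρ x (star x) (fun w => Complex.exp (s * w)) h ∂μ := by
      rw [← integral_mul_left_eq_self (μ := μ)
        (fun h => psKer ρ x (star x) (fun w => Complex.exp (s * w)) h) k]
      refine integral_congr_ae (Filter.Eventually.of_forall fun h => ?_)
      have e1 : psAct (ρ k)ᵀ (star x) = x := by
        rw [← hinvT]; exact ps_act_inj hkx
      simp only [psKer, map_mul, Matrix.transpose_mul, ps_act_mul]
      rw [ps_act_dot (ρ k), e1]
    rw [hsec, hfirst, ← two_smul ℝ, smul_smul] at hmem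
    set J := ∫ h, Complex.exp (s * (-(D h / 2) + θ h * Complex.I)) •
        psAct (ρ h)ᵀ (star x) ∂μ with hJ
    have hJm : J ∈ psV ρ x := by
      have := Submodule.smul_mem _ ((2 * Real.exp (s * nx))⁻¹) hmem
      rwa [smul_smul, inv_mul_cancel₀ (by positivity), one_smul] at this
    refine ⟨M⁻¹ • J, Submodule.smul_mem _ _ hJm, ?_⟩
    rw [dist_comm, dist_eq_norm]
    have e2 : M⁻¹ • J - star x = M⁻¹ • (J - M • star x) := by
      rw [smul_sub, smul_smul, inv_mul_cancel₀ hM.ne', one_smul]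
    rw [e2, norm_smul, Real.norm_eq_abs, abs_of_pos (inv_pos.2 hM)]
    calc M⁻¹ * ‖J - M • star x‖ ≤ M⁻¹ * (e / 2 * M) := by gcongr
      _ = e / 2 := by field_simp
      _ < e := half_lt_self he
  · push Not at hcase
    obtain ⟨κ, hκ, hκD⟩ : ∃ κ > 0, ∀ h, 2 * κ ≤ ∑ i, ‖(psAct (ρ h) x - star x) i‖ ^ 2 := by
      have hc2 : Continuous fun h => ∑ i, ‖(psAct (ρ h) x - star x) i‖ ^ 2 := by
        simp only [Pi.sub_apply]; fun_prop
      obtain ⟨h0, -, hmin⟩ := isCompact_univ.exists_isMinOn ⟨(1 : K), trivial⟩ hc2.continuousOn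
      refine ⟨(∑ i, ‖(psAct (ρ h0) x - star x) i‖ ^ 2) / 2, half_pos ?_, fun h => ?_⟩
      · by_contra! hcon
        have h0' := le_antisymm hcon (Finset.sum_nonneg fun i _ => by positivity)
        rw [Finset.sum_eq_zero_iff_of_nonneg (fun i _ => by positivity)] at h0'
        refine hcase h0 (funext fun i => ?_)
        have := h0' i (Finset.mem_univ i)
        simpa [sub_eq_zero] using this
      · have := hmin (Set.mem_univ h)
        simp only [Set.mem_ofPred_eq] at this
        linarith
    obtain ⟨R, hR⟩ := (isCompact_range (hGc x)).isBounded.exists_norm_le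
    have hR : ∀ h, ‖psAct (ρ h)ᵀ x‖ ≤ |R| := fun h => (hR _ ⟨h, rfl⟩).trans (le_abs_self R)
    obtain ⟨d, hd, hde⟩ : ∃ d > 0, d * (1 + |R|) < e :=
      ⟨e / (2 * (1 + |R|)), by positivity, by
        rw [div_mul_eq_mul_div, div_lt_iff₀ (by positivity)]
        have : 0 < e * (1 + |R|) := by positivity
        linarith⟩
    obtain ⟨s, M, hs, hM, hsmall, hest⟩ := ps_laplace μ u huc D hDc hDu hD0 θ hθc hθ
      (fun h => psAct (ρ h)ᵀ (star x)) (hGc _) (star x) hGD hκ hd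
    have hmem := ps_exp_mem μ ρ hρ x s
    rw [integral_add (hInteg _ _) (hInteg _ _), hfirst] at hmem
    set J := ∫ h, Complex.exp (s * (-(D h / 2) + θ h * Complex.I)) •
        psAct (ρ h)ᵀ (star x) ∂μ with hJ
    set L := ∫ h, psKer ρ x x (fun w => Complex.exp (s * w)) h ∂μ with hL
    have hLn : ‖L‖ ≤ Real.exp (s * nx) * (Real.exp (-(s * κ)) * |R|) := by
      have hp : ∀ h, ‖psKer ρ x x (fun w => Complex.exp (s * w)) h‖ ≤
          Real.exp (s * nx) * (Real.exp (-(s * κ)) * |R|) := by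
        intro h
        simp only [psKer, norm_smul, Complex.norm_exp, Complex.re_ofReal_mul]
        have h1 := hκD h
        rw [ps_expand, hnorm h, star_star] at h1
        have h2 : ∑ i, ‖star x i‖ ^ 2 = nx := by simp [hnx]
        rw [h2] at h1
        rw [← mul_assoc, ← Real.exp_add]
        gcongr
        · have : (x ⬝ᵥ psAct (ρ h) x).re ≤ nx - κ := by linarith
          nlinarith
        · exact hR h
      have := norm_integral_le_of_norm_le_const (μ := μ) (Filter.Eventually.of_forall hp)
      simpa using this
    have hJm : J + (Real.exp (s * nx))⁻¹ • L ∈ psV ρ x := by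
      have := Submodule.smul_mem _ ((Real.exp (s * nx))⁻¹) hmem
      rwa [smul_add, smul_smul, inv_mul_cancel₀ (by positivity), one_smul] at this
    refine ⟨M⁻¹ • (J + (Real.exp (s * nx))⁻¹ • L), Submodule.smul_mem _ _ hJm, ?_⟩
    rw [dist_comm, dist_eq_norm]
    have e2 : M⁻¹ • (J + (Real.exp (s * nx))⁻¹ • L) - star x
        = M⁻¹ • ((J - M • star x) + (Real.exp (s * nx))⁻¹ • L) := by
      rw [smul_add, smul_add, smul_sub, smul_smul M⁻¹ M, inv_mul_cancel₀ hM.ne', one_smul]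
      abel
    rw [e2, norm_smul, Real.norm_eq_abs, abs_of_pos (inv_pos.2 hM)]
    have h3 : ‖(Real.exp (s * nx))⁻¹ • L‖ ≤ d * M * |R| := by
      rw [norm_smul, norm_inv, Real.norm_eq_abs, Real.abs_exp]
      calc _ ≤ (Real.exp (s * nx))⁻¹ * (Real.exp (s * nx) * (Real.exp (-(s * κ)) * |R|)) := by
            gcongr
        _ = Real.exp (-(s * κ)) * |R| := by
            rw [← mul_assoc, inv_mul_cancel₀ (by positivity), one_mul]
        _ ≤ _ := by gcongr
    calc M⁻¹ * ‖(J - M • star x) + (Real.exp (s * nx))⁻¹ • L‖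
        ≤ M⁻¹ * (d * M + d * M * |R|) := by
          gcongr
          exact (norm_add_le _ _).trans (add_le_add hest h3)
      _ = d * (1 + |R|) := by field_simp
      _ < e := hde

end grp3

theorem ps_aeval_coe {n : ℕ} (y : Fin n → ℝ) (r : MvPolynomial (Fin n) ℝ) :
    aeval (fun i => (y i : ℂ)) r = ((eval y r : ℝ) : ℂ) := by
  have := MvPolynomial.aeval_algebraMap_apply ℂ y r
  simpa [MvPolynomial.aeval_eq_eval, Function.comp_def] using this

theorem ps_aeval_cont {n : ℕ} (r : MvPolynomial (Fin n) ℝ) :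
    Continuous fun y : Fin n → ℂ => aeval y r := by
  have : (fun y : Fin n → ℂ => aeval y r) = fun y => eval y (map (algebraMap ℝ ℂ) r) := by
    funext y
    rw [eval_map, aeval_def]
  rw [this]
  exact MvPolynomial.continuous_eval _

theorem ps_chain {n m : ℕ} (π : Fin m → MvPolynomial (Fin n) ℝ) (F : MvPolynomial (Fin m) ℝ)
    (j : Fin n) : pderiv j (aeval π F) = ∑ i, aeval π (pderiv i F) * pderiv j (π i) := by
  induction F using MvPolynomial.induction_on with
  | C a => simp [algebraMap_eq]
  | add p q hp hq => simp only [map_add, hp, hq, add_mul, Finset.sum_add_distrib]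
  | mul_X p i hp =>
    rw [map_mul, Derivation.leibniz, hp]
    simp only [aeval_X, smul_eq_mul, Derivation.leibniz, map_add, map_mul, add_mul,
      Finset.sum_add_distrib, Finset.mul_sum]
    congr 1
    · rw [Finset.sum_eq_single i]
      · simp
      · intro b _ hb; simp [pderiv_X, hb.symm]
      · simp
    · refine Finset.sum_congr rfl fun k _ => ?_
      ring

theorem ps_aeval_comp {n m : ℕ} (π : Fin m → MvPolynomial (Fin n) ℝ) (x : Fin n → ℂ)
    (z : Fin m → ℝ) (hx : ∀ i, aeval x (π i) = (z i : ℂ)) (r : MvPolynomial (Fin m) ℝ) :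
    aeval x (aeval π r) = ((eval z r : ℝ) : ℂ) := by
  rw [← ps_aeval_coe]
  have : (aeval x).comp (aeval π) =
      (aeval (fun i => (z i : ℂ)) : MvPolynomial (Fin m) ℝ →ₐ[ℝ] ℂ) := by
    apply MvPolynomial.algHom_ext
    intro i
    simp [hx]
  exact congrArg (fun g => g r) this

section grp4
variable {n m : ℕ} {K : Type} [Group K] [TopologicalSpace K] [IsTopologicalGroup K] [CompactSpace K]
    [MeasurableSpace K] [BorelSpace K]

theorem ps_fibre (μ : Measure K) [IsProbabilityMeasure μ] [μ.IsMulLeftInvariant]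
    [μ.IsMulRightInvariant] (ρ : K →* Matrix (Fin n) (Fin n) ℝ) (hρ : Continuous ρ)
    (π : Fin m → MvPolynomial (Fin n) ℝ) (hinv : ∀ h i, polyAct (ρ h) (π i) = π i)
    (hgen : ∀ f : MvPolynomial (Fin n) ℝ, (∀ g, polyAct (ρ g) f = f) → ∃ F : MvPolynomial (Fin m) ℝ, aeval π F = f)
    (z : Fin m → ℝ) (hrel : ∀ r : MvPolynomial (Fin m) ℝ, aeval π r = 0 → eval z r = 0) :
    ∃ y : Fin n → ℂ, ∀ i, aeval y (π i) = (z i : ℂ) := by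
  by_contra! hcon
  set I : Ideal (MvPolynomial (Fin n) ℝ) := Ideal.span (Set.range fun i => π i - C (z i)) with hI
  have hz : zeroLocus ℂ I = ∅ := by
    rw [hI, zeroLocus_span]
    ext y
    simp only [Set.mem_ofPred_eq, Set.mem_empty_iff_false, iff_false]
    intro hy
    obtain ⟨i, hi⟩ := hcon y
    apply hi
    have := hy _ ⟨i, rfl⟩
    simpa [sub_eq_zero] using this
  have h1 := vanishingIdeal_zeroLocus_eq_radical (K := ℂ) I
  rw [hz, vanishingIdeal_empty] at h1
  have h2 : (1 : MvPolynomial (Fin n) ℝ) ∈ I := by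
    have : I = ⊤ := Ideal.radical_eq_top.1 h1.symm
    rw [this]; trivial
  rw [hI, Ideal.mem_span_range_iff_exists_fun] at h2
  obtain ⟨c, hc⟩ := h2
  choose F hF hFT using fun i => ps_avg μ ρ hρ (c i)
  choose r hr using fun i => hgen (F i) (hF i)
  have hrel0 : aeval π (1 - ∑ i, r i * (X i - C (z i))) = 0 := by
    apply MvPolynomial.funext
    intro y
    have e1 : aeval π (1 - ∑ i, r i * (X i - C (z i))) = 1 - ∑ i, F i * (π i - C (z i)) := by
      simp only [map_sub, map_one, map_sum, map_mul, aeval_X, aeval_C, hr, algebraMap_eq]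
    rw [e1]
    have hinv2 : ∀ h i, aeval (psAct (ρ h) (fun i => (y i : ℂ))) (π i)
        = aeval (fun i => (y i : ℂ)) (π i) := by
      intro h i
      rw [← ps_aeval_polyAct, hinv]
    have e2 : ∑ i, aeval (fun i => (y i : ℂ)) (F i) * (aeval (fun i => (y i : ℂ)) (π i) - z i)
        = (1 : ℂ) := by
      have e3 : ∀ i, aeval (fun i => (y i : ℂ)) (F i)
          = ∫ h, aeval (psAct (ρ h) (fun i => (y i : ℂ))) (c i) ∂μ := by
        intro i
        have := hFT i ((aeval (fun i => (y i : ℂ)) : MvPolynomial (Fin n) ℝ →ₐ[ℝ] ℂ).toLinearMap)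
        simpa only [AlgHom.toLinearMap_apply, ps_aeval_polyAct] using this
      simp only [e3, ← integral_mul_const]
      rw [← integral_finsetSum]
      · have : ∀ h, ∑ i, aeval (psAct (ρ h) (fun i => (y i : ℂ))) (c i) *
            (aeval (fun i => (y i : ℂ)) (π i) - z i) = 1 := by
          intro h
          have := congrArg (aeval (psAct (ρ h) (fun i => (y i : ℂ)))) hc
          simpa [hinv2] using this
        simp [this]
      · intro i _
        apply ps_integrable
        exact ((ps_aeval_cont _).comp (ps_act_cont hρ _)).mul continuous_const
    simp only [ps_aeval_coe] at e2
    simp only [map_sub, map_one, map_sum, map_mul, eval_C, map_zero]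
    have e4 : ∑ i, eval y (F i) * (eval y (π i) - z i) = 1 := by exact_mod_cast e2
    rw [e4, sub_self]
  have := hrel _ hrel0
  simp at this

theorem ps_min (π : Fin m → MvPolynomial (Fin n) ℝ) (z : Fin m → ℝ)
    (hne : ∃ y : Fin n → ℂ, ∀ i, aeval y (π i) = (z i : ℂ)) :
    ∃ x : Fin n → ℂ, (∀ i, aeval x (π i) = (z i : ℂ)) ∧
      ∀ y : Fin n → ℂ, (∀ i, aeval y (π i) = (z i : ℂ)) → ∑ i, ‖x i‖ ^ 2 ≤ ∑ i, ‖y i‖ ^ 2 := by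
  obtain ⟨y0, hy0⟩ := hne
  have hfc : Continuous fun y : Fin n → ℂ => ∑ i, ‖y i‖ ^ 2 := by fun_prop
  set S : Set (Fin n → ℂ) := {y | (∀ i, aeval y (π i) = (z i : ℂ)) ∧
    ∑ i, ‖y i‖ ^ 2 ≤ ∑ i, ‖y0 i‖ ^ 2} with hS
  have hSc : IsClosed S := by
    have : S = (⋂ i, {y | aeval y (π i) = (z i : ℂ)}) ∩ {y | ∑ i, ‖y i‖ ^ 2 ≤ ∑ i, ‖y0 i‖ ^ 2} := by
      ext y; simp [hS]
    rw [this]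
    exact (isClosed_iInter fun i => isClosed_eq (ps_aeval_cont _) continuous_const).inter
      (isClosed_le hfc continuous_const)
  have hSb : Bornology.IsBounded S := by
    refine (Metric.isBounded_closedBall (x := (0 : Fin n → ℂ))
      (r := √(∑ i, ‖y0 i‖ ^ 2))).subset fun y hy => ?_
    rw [mem_closedBall_zero_iff]
    exact Real.le_sqrt_of_sq_le ((ps_sup_le y).trans hy.2)
  obtain ⟨x, hx, hmin⟩ := (Metric.isCompact_of_isClosed_isBounded hSc hSb).exists_isMinOn
    ⟨y0, hy0, le_rfl⟩ hfc.continuousOn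
  refine ⟨x, hx.1, fun y hy => ?_⟩
  rcases le_total (∑ i, ‖y i‖ ^ 2) (∑ i, ‖y0 i‖ ^ 2) with h | h
  · exact hmin ⟨hy, h⟩
  · exact hx.2.trans h

theorem ps_self_mem (ρ : K →* Matrix (Fin n) (Fin n) ℝ)
    (hO : ∀ h, (ρ h)ᵀ * ρ h = 1) (x : Fin n → ℂ) : x ∈ psV ρ x := by
  refine ⟨C (1 / 2) * ∑ i, X i ^ 2, fun g => ?_, fun j => ?_⟩
  · rw [map_mul, map_sum]
    have h0 : polyAct (ρ g) (C (1 / 2)) = C (1 / 2) := by simp [polyAct, algebraMap_eq]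
    rw [h0]
    congr 1
    apply MvPolynomial.funext
    intro y
    have h1 : ∀ i, eval y (polyAct (ρ g) (X i ^ 2)) = (ρ g *ᵥ y) i ^ 2 := by
      intro i
      simp [polyAct, Matrix.mulVec, dotProduct]
    have h2 : (ρ g *ᵥ y) ⬝ᵥ (ρ g *ᵥ y) = y ⬝ᵥ y := by
      rw [Matrix.dotProduct_mulVec, ← Matrix.mulVec_transpose, Matrix.mulVec_mulVec, hO,
        Matrix.one_mulVec]
    rw [map_sum, map_sum, Finset.sum_congr rfl fun i _ => h1 i]
    simpa [dotProduct, pow_two] using h2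
  · rw [Derivation.leibniz, map_sum, Finset.sum_eq_single j]
    · simp
    · intro b _ hb
      simp [pderiv_X, hb]
    · simp

theorem ps_main (μ : Measure K) [IsProbabilityMeasure μ] [μ.IsMulLeftInvariant]
    [μ.IsMulRightInvariant] (ρ : K →* Matrix (Fin n) (Fin n) ℝ) (hρ : Continuous ρ)
    (hO : ∀ h, (ρ h)ᵀ * ρ h = 1)
    (π : Fin m → MvPolynomial (Fin n) ℝ) (hinv : ∀ h i, polyAct (ρ h) (π i) = π i)
    (hgen : ∀ f : MvPolynomial (Fin n) ℝ, (∀ g, polyAct (ρ g) f = f) → ∃ F : MvPolynomial (Fin m) ℝ, aeval π F = f)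
    (q : Fin m → Fin m → MvPolynomial (Fin m) ℝ)
    (hq : ∀ i j, aeval π (q i j) = ∑ k, pderiv k (π i) * pderiv k (π j))
    (z : Fin m → ℝ) (hrel : ∀ r : MvPolynomial (Fin m) ℝ, aeval π r = 0 → eval z r = 0)
    (hpsd : (Matrix.of fun i j => eval z (q i j)).PosSemidef) :
    ∃ a : Fin n → ℝ, ∀ i, eval a (π i) = z i := by
  obtain ⟨x, hx, hmin⟩ := ps_min π z (ps_fibre μ ρ hρ π hinv hgen z hrel)
  have hst : star x ∈ psV ρ x := ps_star_mem μ ρ hρ hO x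
    fun ε hε => ps_theta ρ hρ hO π hinv z x hx hmin hε
  have hv : x - star x ∈ psV ρ x := Submodule.sub_mem _ (ps_self_mem ρ hO x) hst
  obtain ⟨p, hp, hpv⟩ := hv
  obtain ⟨F, rfl⟩ := hgen p hp
  set r : Fin m → ℝ := fun i => eval z (pderiv i F) with hr
  have h1 : ∀ j, (x - star x) j = ∑ i, (r i : ℂ) * aeval x (pderiv j (π i)) := by
    intro j
    rw [hpv j, ps_chain, map_sum]
    refine Finset.sum_congr rfl fun i _ => ?_
    rw [map_mul, ps_aeval_comp π x z hx]
  have h2 : ∑ j, (x - star x) j ^ 2 = ((r ⬝ᵥ ((Matrix.of fun i j => eval z (q i j)) *ᵥ r) : ℝ) : ℂ) := by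
    have e1 : ∀ i k, ((eval z (q i k) : ℝ) : ℂ)
        = ∑ j, aeval x (pderiv j (π i)) * aeval x (pderiv j (π k)) := by
      intro i k
      rw [← ps_aeval_comp π x z hx, hq]
      simp
    simp only [dotProduct, Matrix.mulVec, Matrix.of_apply]
    push_cast
    simp only [e1, h1, pow_two, Finset.mul_sum, Finset.sum_mul]
    rw [Finset.sum_comm]
    refine Finset.sum_congr rfl fun i _ => ?_
    rw [Finset.sum_comm]
    refine Finset.sum_congr rfl fun k _ => Finset.sum_congr rfl fun j _ => ?_
    ring
  have h3 : 0 ≤ r ⬝ᵥ ((Matrix.of fun i j => eval z (q i j)) *ᵥ r) := by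
    simpa using hpsd.dotProduct_mulVec_nonneg r
  have h4 : ∑ j, (x - star x) j ^ 2 = ((∑ j, -(4 * (x j).im ^ 2) : ℝ) : ℂ) := by
    push_cast
    refine Finset.sum_congr rfl fun j _ => ?_
    have : (x - star x) j = 2 * (x j).im * Complex.I := by
      apply Complex.ext <;> simp
      ring
    rw [this]
    linear_combination (4 * ((x j).im : ℂ) ^ 2) * Complex.I_sq
  have h5 : ∑ j, -(4 * (x j).im ^ 2) = r ⬝ᵥ ((Matrix.of fun i j => eval z (q i j)) *ᵥ r) := by
    exact_mod_cast h4.symm.trans h2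
  rw [← h5, Finset.sum_neg_distrib] at h3
  have h6 : ∑ j, 4 * (x j).im ^ 2 = 0 :=
    le_antisymm (by linarith) (Finset.sum_nonneg fun j _ => by positivity)
  rw [Finset.sum_eq_zero_iff_of_nonneg (fun j _ => by positivity)] at h6
  refine ⟨fun j => (x j).re, fun i => ?_⟩
  have h7 : (fun j => (((x j).re : ℝ) : ℂ)) = x := by
    funext j
    have := h6 j (Finset.mem_univ j)
    apply Complex.ext
    · simp
    · simp only [Complex.ofReal_im]
      have h8 : (x j).im ^ 2 = 0 := by linarith
      exact (pow_eq_zero_iff two_ne_zero).1 h8 |>.symm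
  have h8 := ps_aeval_coe (fun j => (x j).re) (π i)
  rw [h7, hx i] at h8
  exact_mod_cast h8.symm

end grp4

end psHelpers

/-- **Procesi–Schwarz theorem.**  Let `H` be a compact subgroup of the orthogonal group
`O_n(ℝ)` with fundamental invariants `π_1, …, π_m`, let `Π : ℝ^n → ℝ^m` be the Hilbert
map `x ↦ (π_1(x), …, π_m(x))`, and let `q i j ∈ ℝ[z_1,…,z_m]` satisfy
`q i j (π_1,…,π_m) = Σ_k ∂π_i/∂x_k · ∂π_j/∂x_k` (the invariant inner products of the
differentials `⟨dπ_i, dπ_j⟩`).  Then the orbit space `ℝ^n/H`, i.e. the image of the Hilbert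
map, is the basic semialgebraic set
`{z ∈ ℝ^m : q(z) = 0 for all relations q of the π's, and (q i j (z))_{i,j} ⪰ 0}`. -/
theorem procesi_schwarz {n m : ℕ}
    (H : Subgroup (Matrix.orthogonalGroup (Fin n) ℝ))
    (hcompact : IsCompact ((H : Set (Matrix.orthogonalGroup (Fin n) ℝ))))
    (π : Fin m → MvPolynomial (Fin n) ℝ)
    (hinv : ∀ i, ∀ g : ↥H, orthAct H g (π i) = π i)
    (hgen : ∀ f : MvPolynomial (Fin n) ℝ, (∀ g : ↥H, orthAct H g f = f) →
      f ∈ Algebra.adjoin ℝ (Set.range π))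
    (q : Fin m → Fin m → MvPolynomial (Fin m) ℝ)
    (hq : ∀ i j, MvPolynomial.aeval π (q i j) =
      ∑ k, MvPolynomial.pderiv k (π i) * MvPolynomial.pderiv k (π j)) :
    (Set.range fun x : Fin n → ℝ => fun i => MvPolynomial.eval x (π i)) =
      {z : Fin m → ℝ |
        (∀ r : MvPolynomial (Fin m) ℝ, MvPolynomial.aeval π r = 0 →
          MvPolynomial.eval z r = 0) ∧
        (Matrix.of fun i j => MvPolynomial.eval z (q i j)).PosSemidef} := by
  ext z
  constructor
  · rintro ⟨a, rfl⟩
    refine ⟨fun r hr => ?_, ?_⟩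
    · have h1 := ps_aeval_comp π (fun i => (a i : ℂ)) (fun i => eval a (π i))
        (fun i => ps_aeval_coe a (π i)) r
      rw [hr, map_zero] at h1
      exact_mod_cast h1.symm
    · have h1 : (Matrix.of fun i j => eval (fun i => eval a (π i)) (q i j)) =
          (Matrix.of fun i k => eval a (pderiv k (π i)))
            * (Matrix.of fun i k => eval a (pderiv k (π i)))ᴴ := by
        ext i j
        have h2 := ps_aeval_comp π (fun i => (a i : ℂ)) (fun i => eval a (π i))
          (fun i => ps_aeval_coe a (π i)) (q i j)
        rw [hq, ps_aeval_coe] at h2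
        have h3 := Complex.ofReal_injective h2
        simp only [Matrix.of_apply, Matrix.mul_apply, Matrix.conjTranspose_apply, star_trivial]
        rw [← h3]
        simp
      rw [h1]
      exact Matrix.posSemidef_self_mul_conjTranspose _
  · rintro ⟨hrel, hpsd⟩
    letI : MeasurableSpace ↥H := borel _
    haveI : BorelSpace ↥H := ⟨rfl⟩
    haveI : CompactSpace ↥H := isCompact_iff_compactSpace.1 hcompact
    obtain ⟨μ, h1, h2, h3⟩ := ps_exists_haar ↥H
    let ρ : ↥H →* Matrix (Fin n) (Fin n) ℝ :=
      (Submonoid.subtype (Matrix.orthogonalGroup (Fin n) ℝ)).comp H.subtype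
    have hρ : Continuous ρ := continuous_subtype_val.comp continuous_subtype_val
    have hO : ∀ h, (ρ h)ᵀ * ρ h = 1 := by
      intro h
      have := (Matrix.mem_orthogonalGroup_iff' (Fin n) ℝ).1
        ((h : Matrix.orthogonalGroup (Fin n) ℝ)).2
      exact this
    have hact : ∀ g f, polyAct (ρ g) f = orthAct H g⁻¹ f := by
      intro g f
      simp only [orthAct, inv_inv]
      rfl
    obtain ⟨a, ha⟩ := ps_main μ ρ hρ hO π (fun h i => by rw [hact, hinv]) (fun f hf => by
        have := hgen f (fun g => by rw [← inv_inv g, ← hact, hf])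
        rw [Algebra.adjoin_range_eq_range_aeval] at this
        exact this) q hq z hrel hpsd
    exact ⟨a, funext ha⟩
end

section
/- Characterization of symmetric quartic sums of squares: let f ∈ ℝ[X_1, …, X_n] be a homogeneous symmetric polynomial of degree 4. Then f is a sum of squares if and only if there exist real numbers α_{11}, α_{12}, α_{22}, β_{11}, β_{12}, β_{22}, γ such that the 2×2 matrices (α_{11}, α_{12}; α_{12}, α_{22}) and (β_{11}, β_{12}; β_{12}, β_{22}) are positive semidefinite, γ ≥ 0, and f = α_{11}π_1⁴ + 2α_{12}π_1²π_2 + α_{22}π_2² + β_{11}(π_1²π_2 − π_1⁴) + 2β_{12}(π_3π_1 − π_1²π_2) + β_{22}(π_4 − π_2²) + γ( (1/2)π_1⁴ − π_1²π_2 + ((n² − 3n + 3)/(2n²))π_2² + ((2n − 2)/n²)π_1π_3 + ((1 − n)/(2n²))π_4 ), where π_j := (1/n)(X_1^j + … + X_n^j) for 1 ≤ j ≤ 4. -/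
open MvPolynomial

lemma inv_tuple {n k : ℕ} (φ : (Fin k ↪ Fin n) → ℝ)
    (h : ∀ (σ : Equiv.Perm (Fin n)) (v : Fin k ↪ Fin n), φ (σ • v) = φ v) : ∃ c, ∀ v, φ v = c := by
  rcases isEmpty_or_nonempty (Fin k ↪ Fin n) with he | ⟨⟨v0⟩⟩
  · exact ⟨0, fun v => (he.false v).elim⟩
  · refine ⟨φ v0, fun v => ?_⟩
    have := Equiv.Perm.isMultiplyPretransitive (Fin n) k
    obtain ⟨σ, hσ⟩ := this.exists_smul_eq v0 v
    rw [← hσ, h]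

lemma inv2 {n : ℕ} (φ : Fin n → Fin n → ℝ)
    (h : ∀ (σ : Equiv.Perm (Fin n)) i j, φ (σ i) (σ j) = φ i j) :
    ∃ c, ∀ i j, i ≠ j → φ i j = c := by
  obtain ⟨c, hc⟩ := inv_tuple (k := 2) (fun v => φ (v 0) (v 1)) (fun σ v => h σ _ _)
  refine ⟨c, fun i j hij => ?_⟩
  have := hc ⟨![i, j], by
    intro a b; fin_cases a <;> fin_cases b <;> simp [hij, hij.symm]⟩
  exact this

lemma inv3 {n : ℕ} (φ : Fin n → Fin n → Fin n → ℝ)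
    (h : ∀ (σ : Equiv.Perm (Fin n)) i j k, φ (σ i) (σ j) (σ k) = φ i j k) :
    ∃ c, ∀ i j k, i ≠ j → i ≠ k → j ≠ k → φ i j k = c := by
  obtain ⟨c, hc⟩ := inv_tuple (k := 3) (fun v => φ (v 0) (v 1) (v 2)) (fun σ v => h σ _ _ _)
  refine ⟨c, fun i j k h1 h2 h3 => ?_⟩
  have := hc ⟨![i, j, k], by
    intro a b; fin_cases a <;> fin_cases b <;> simp [h1, h2, h3, h1.symm, h2.symm, h3.symm]⟩
  exact this

lemma inv4 {n : ℕ} (φ : Fin n → Fin n → Fin n → Fin n → ℝ)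
    (h : ∀ (σ : Equiv.Perm (Fin n)) i j k l, φ (σ i) (σ j) (σ k) (σ l) = φ i j k l) :
    ∃ c, ∀ i j k l, i ≠ j → i ≠ k → i ≠ l → j ≠ k → j ≠ l → k ≠ l → φ i j k l = c := by
  obtain ⟨c, hc⟩ := inv_tuple (k := 4) (fun v => φ (v 0) (v 1) (v 2) (v 3))
    (fun σ v => h σ _ _ _ _)
  refine ⟨c, fun i j k l h1 h2 h3 h4 h5 h6 => ?_⟩
  have := hc ⟨![i, j, k, l], by
    intro a b; fin_cases a <;> fin_cases b <;> simp [h1, h2, h3, h1.symm, h2.symm, h3.symm,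
      h4, h5, h6, h4.symm, h5.symm, h6.symm]⟩
  exact this

/-- quadratic forms -/
lemma quad_form {n : ℕ} (p : MvPolynomial (Fin n) ℝ) (hp : p.IsHomogeneous 2) :
    ∃ A : Fin n → Fin n → ℝ, (∀ i j, A i j = A j i) ∧
      ∀ x, eval x p = ∑ i, ∑ j, A i j * (x i * x j) := by
  suffices H : ∃ A : Fin n → Fin n → ℝ, ∀ x, eval x p = ∑ i, ∑ j, A i j * (x i * x j) by
    obtain ⟨A, hA⟩ := H
    refine ⟨fun i j => (A i j + A j i) / 2, fun i j => by ring, fun x => ?_⟩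
    have h1 := hA x
    have h2 := h1
    rw [Finset.sum_comm] at h2
    have : ∀ i j, (A i j + A j i) / 2 * (x i * x j)
        = (1/2) * (A i j * (x i * x j)) + (1/2) * (A j i * (x j * x i)) := by intros; ring
    simp only [this, Finset.sum_add_distrib, ← Finset.mul_sum]
    rw [← h1, ← h2]; ring
  rw [p.as_sum]
  refine Finset.sum_induction _ (fun q : MvPolynomial (Fin n) ℝ => 
    ∃ A : Fin n → Fin n → ℝ, ∀ x, eval x q = ∑ i, ∑ j, A i j * (x i * x j)) ?_ ?_ ?_
  · rintro a b ⟨A, hA⟩ ⟨B, hB⟩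
    refine ⟨fun i j => A i j + B i j, fun x => ?_⟩
    simp only [map_add, hA, hB, add_mul, Finset.sum_add_distrib]
  · exact ⟨0, by simp⟩
  · intro d hd
    have h2 : d.degree = 2 := by
      have := hp (mem_support_iff.1 hd)
      rw [Finsupp.degree_eq_weight_one]; exact this
    have hd0 : d ≠ 0 := by rintro rfl; simp at h2
    obtain ⟨i, hi⟩ := Finsupp.ne_iff.1 hd0
    have hle : Finsupp.single i 1 ≤ d := by
      simp; simp at hi; omega
    obtain ⟨d', rfl⟩ := le_iff_exists_add.1 hle
    have h1 : d'.degree = 1 := by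
      rw [map_add, Finsupp.degree_single] at h2; omega
    have hd0' : d' ≠ 0 := by rintro rfl; simp at h1
    obtain ⟨j, hj⟩ := Finsupp.ne_iff.1 hd0'
    have hle' : Finsupp.single j 1 ≤ d' := by
      simp; simp at hj; omega
    obtain ⟨d'', rfl⟩ := le_iff_exists_add.1 hle'
    have h0 : d''.degree = 0 := by
      rw [map_add, Finsupp.degree_single] at h1; omega
    have : d'' = 0 := (Finsupp.degree_eq_zero_iff _).1 h0
    subst this
    set c := coeff (Finsupp.single i 1 + (Finsupp.single j 1 + 0)) p
    refine ⟨fun k l => if k = i then if l = j then c else 0 else 0, fun x => ?_⟩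
    have : monomial (Finsupp.single i 1 + (Finsupp.single j 1 + 0)) c = C c * (X i * X j) := by
      simp [X, monomial_mul, C_mul_monomial]
    rw [this]
    simp [ite_mul]


lemma coeff_line {n : ℕ} (x : Fin n → ℝ) (p : MvPolynomial (Fin n) ℝ) (k : ℕ) :
    (aeval (fun i => Polynomial.C (x i) * Polynomial.X) p : Polynomial ℝ).coeff k
      = eval x (homogeneousComponent k p) := by
  induction p using MvPolynomial.induction_on' with
  | add p q hp hq => simp [hp, hq]
  | monomial d c =>
    have h1 : (aeval (fun i => Polynomial.C (x i) * Polynomial.X) (monomial d c) : Polynomial ℝ)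
        = Polynomial.C (eval x (monomial d c)) * Polynomial.X ^ d.degree := by
      rw [aeval_monomial, eval_monomial]
      simp only [Finsupp.prod, mul_pow, Finset.prod_mul_distrib, Finset.prod_pow_eq_pow_sum,
        Finsupp.degree, map_mul, map_prod, map_pow]
      rw [mul_assoc]; rfl
    rw [h1, Polynomial.coeff_C_mul_X_pow, homogeneousComponent_of_mem
      (isHomogeneous_monomial c (rfl : d.degree = d.degree))]
    split_ifs <;> simp

lemma to_quad {n : ℕ} (f : MvPolynomial (Fin n) ℝ) (hf4 : f.IsHomogeneous 4) {l : ℕ}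
    (p : Fin l → MvPolynomial (Fin n) ℝ) (hp : f = ∑ t, (p t)^2) (x : Fin n → ℝ) :
    eval x f = ∑ t, (eval x (homogeneousComponent 2 (p t)))^2 := by
  set L : MvPolynomial (Fin n) ℝ →ₐ[ℝ] Polynomial ℝ :=
    aeval (fun i => Polynomial.C (x i) * Polynomial.X) with hL
  have hc : ∀ q k, (L q).coeff k = eval x (homogeneousComponent k q) := coeff_line x
  have hfk : ∀ k, (L f).coeff k = if k = 4 then eval x f else 0 := by
    intro k
    rw [hc, homogeneousComponent_of_mem hf4]
    by_cases h : k = 4 <;> simp [h]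
  have hs : L f = ∑ t, (L (p t))^2 := by rw [hp]; simp
  have c0 : ∀ t, (L (p t)).coeff 0 = 0 := by
    have := hfk 0
    rw [hs, Polynomial.finsetSum_coeff] at this
    simp only [pow_two, Polynomial.mul_coeff_zero] at this
    norm_num at this
    rw [Finset.sum_eq_zero_iff_of_nonneg (fun t _ => mul_self_nonneg _)] at this
    intro t; simpa using this t (Finset.mem_univ t)
  have c1 : ∀ t, (L (p t)).coeff 1 = 0 := by
    have := hfk 2
    rw [hs, Polynomial.finsetSum_coeff] at this
    simp only [pow_two, Polynomial.coeff_mul, Finset.Nat.sum_antidiagonal_eq_sum_range_succ_mk,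
      Finset.sum_range_succ, Finset.sum_range_zero, c0] at this
    norm_num at this
    rw [Finset.sum_eq_zero_iff_of_nonneg (fun t _ => mul_self_nonneg _)] at this
    intro t; simpa using this t (Finset.mem_univ t)
  have := hfk 4
  rw [hs, Polynomial.finsetSum_coeff] at this
  simp only [pow_two, Polynomial.coeff_mul, Finset.Nat.sum_antidiagonal_eq_sum_range_succ_mk,
      Finset.sum_range_succ, Finset.sum_range_zero, c0, c1] at this
  norm_num at this
  rw [← this]
  simp only [hc, pow_two]

lemma psd_iff (a b c : ℝ) : (Matrix.of ![![a, b], ![b, c]]).PosSemidef ↔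
    ∀ s t, 0 ≤ a * s^2 + 2 * b * s * t + c * t^2 := by
  rw [Matrix.posSemidef_iff_dotProduct_mulVec]
  constructor
  · rintro ⟨-, h⟩ s t
    have := h ![s, t]
    simp [Matrix.mulVec, dotProduct, Fin.sum_univ_two] at this
    linarith
  · intro h
    refine ⟨?_, fun x => ?_⟩
    · ext i j; fin_cases i <;> fin_cases j <;> simp
    · have := h (x 0) (x 1)
      simp [Matrix.mulVec, dotProduct, Fin.sum_univ_two]
      linarith

lemma psd_factor (a b c : ℝ) (h : ∀ s t, 0 ≤ a * s^2 + 2 * b * s * t + c * t^2) :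
    ∃ p r w : ℝ, a = p^2 ∧ b = p * r ∧ c = r^2 + w^2 := by
  have ha : 0 ≤ a := by simpa using h 1 0
  have hc : 0 ≤ c := by simpa using h 0 1
  rcases ha.eq_or_lt with ha0 | ha0
  · subst ha0
    have hb : b = 0 := by
      by_contra hb
      have := h (-(c + 1) / (2 * b)) 1
      have e : 0 * (-(c + 1) / (2 * b))^2 + 2 * b * (-(c + 1) / (2 * b)) * 1 + c * 1^2 = -1 := by
        field_simp; ring
      linarith
    refine ⟨0, 0, √c, by simp, by simp [hb], by simp [Real.sq_sqrt hc]⟩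
  · have hd : 0 ≤ c - b^2/a := by
      have := h (-b/a) 1
      have e : a * (-b/a)^2 + 2 * b * (-b/a) * 1 + c * 1^2 = c - b^2/a := by field_simp; ring
      linarith
    refine ⟨√a, b/√a, √(c - b^2/a), (Real.sq_sqrt ha).symm, ?_, ?_⟩
    · field_simp
    · rw [Real.sq_sqrt hd, div_pow, Real.sq_sqrt ha]; ring

/-- the kernel m is given by seven values -/
def Pattern {n : ℕ} (m : Fin n → Fin n → Fin n → Fin n → ℝ) (a b c d e g h : ℝ) : Prop :=
  (∀ i, m i i i i = a) ∧ (∀ i j, i ≠ j → m i i j j = b) ∧ (∀ i j, i ≠ j → m i i i j = c) ∧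
  (∀ i j k, i ≠ j → i ≠ k → j ≠ k → m i i j k = d) ∧ (∀ i j, i ≠ j → m i j i j = e) ∧
  (∀ i j k, i ≠ j → i ≠ k → j ≠ k → m i j i k = g) ∧
  (∀ i j k l, i ≠ j → i ≠ k → i ≠ l → j ≠ k → j ≠ l → k ≠ l → m i j k l = h)

lemma pattern_apply {n : ℕ} {m : Fin n → Fin n → Fin n → Fin n → ℝ} {a b c d e g h : ℝ}
    (hm : Pattern m a b c d e g h) (hs1 : ∀ i j k l, m i j k l = m j i k l)
    (hs2 : ∀ i j k l, m i j k l = m k l i j) (i j k l : Fin n) :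
    m i j k l = if i = j then
      (if k = l then (b + (a - b) * if i = k then 1 else 0) else
        (d + (c - d) * ((if k = i then 1 else 0) + if l = i then 1 else 0)))
      else if k = l then (d + (c - d) * ((if i = k then 1 else 0) + if j = k then 1 else 0))
      else h + (g - h) * ((if k = i then 1 else 0) + (if l = i then 1 else 0) +
         (if k = j then 1 else 0) + (if l = j then 1 else 0)) +
         (e - 2 * g + h) * ((if k = i then if l = j then 1 else 0 else 0) +
           (if k = j then if l = i then 1 else 0 else 0)) := by
  obtain ⟨ha, hb, hc, hd, he, hg, hh⟩ := hm
  have hs3 : ∀ i j k l, m i j k l = m i j l k := fun i j k l => by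
    rw [hs2, hs1, hs2]
  by_cases hij : i = j
  · subst hij
    by_cases hkl : k = l
    · subst hkl
      by_cases hik : i = k
      · subst hik; simp [ha]
      · simp [hik, hb i k hik]
    · by_cases hik : k = i
      · subst hik
        simp [hkl, Ne.symm hkl, hc k l hkl]
      · by_cases hil : l = i
        · subst hil
          simp [hik, hs3 l l k l, hc l k (Ne.symm hik)]
        · simp [hik, hil, hkl, hd i k l (Ne.symm hik) (Ne.symm hil) hkl]
  · by_cases hkl : k = l
    · subst hkl
      rw [hs2]
      by_cases hik : i = k
      · subst hik; simp [hij, Ne.symm hij, hc i j hij]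
      · by_cases hjk : j = k
        · subst hjk; rw [hs3]; simp [hij, hc j i (Ne.symm hij)]
        · simp [hij, hik, hjk, hd k i j (Ne.symm hik) (Ne.symm hjk) hij]
    · by_cases hik : k = i
      · subst hik
        by_cases hjl : l = j
        · subst hjl; simp [hij, Ne.symm hij, he k l hij]; ring
        · simp [hij, hkl, hjl, Ne.symm hkl, hg k j l hij hkl (Ne.symm hjl)]
      · by_cases hil : l = i
        · subst hil
          rw [hs3]
          by_cases hjk : k = j
          · subst hjk; simp [hij, hkl, he l k hij]; ring
          · simp [hij, hkl, hjk, hg l j k hij (Ne.symm hik) (Ne.symm hjk)]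
        · by_cases hjk : k = j
          · subst hjk
            rw [hs1]
            simp [hij, hkl, hik, hil, Ne.symm hkl, hg k i l hik hkl (Ne.symm hil)]
          · by_cases hjl : l = j
            · subst hjl
              rw [hs1, hs3]
              simp [hij, hkl, hik, hjk, hil, hg l i k hil (Ne.symm hkl) (Ne.symm hik)]
            · simp [hij, hkl, hik, hil, hjk, hjl, hh i j k l hij (Ne.symm hik) (Ne.symm hil)
                (Ne.symm hjk) (Ne.symm hjl) hkl]

lemma pattern_sum {n : ℕ} {m : Fin n → Fin n → Fin n → Fin n → ℝ} {a b c d e g h : ℝ}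
    (hm : Pattern m a b c d e g h) (hs1 : ∀ i j k l, m i j k l = m j i k l)
    (hs2 : ∀ i j k l, m i j k l = m k l i j) (D : Fin n → ℝ) (O : Fin n → Fin n → ℝ)
    (hO0 : ∀ i, O i i = 0) (hOs : ∀ i j, O i j = O j i) (R : Fin n → ℝ)
    (hR : ∀ i, ∑ j, O i j = R i) :
    ∑ i, ∑ j, ∑ k, ∑ l, m i j k l * (((if i = j then D i else 0) + O i j) *
      ((if k = l then D k else 0) + O k l)) =
     a * ∑ i, D i ^ 2 + b * ((∑ i, D i)^2 - ∑ i, D i ^2)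
      + 2 * (2 * c * ∑ i, D i * R i + d * ((∑ i, D i) * (∑ i, R i) - 2 * ∑ i, D i * R i))
      + h * (∑ i, R i)^2 + 4 * (g - h) * ∑ i, R i ^ 2
      + 2 * (e - 2 * g + h) * ∑ i, ∑ j, O i j ^ 2 := by
  have hR' : ∀ i, ∑ j, O j i = R i := fun i => by rw [← hR]; simp only [hOs]
  have e1 : ∀ i j k l, m i j k l * (((if i = j then D i else 0) + O i j) *
      ((if k = l then D k else 0) + O k l)) =
      b * ((if j = i then D i else 0) * (if l = k then D k else 0)) 
      + (a - b) * (if j = i then if k = i then if l = k then D i ^ 2 else 0 else 0 else 0)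
      + d * ((if j = i then D i else 0) * O k l) 
      + (c - d) * (if j = i then (if k = i then D i * O k l else 0) else 0)
      + (c - d) * (if j = i then (if l = i then D i * O k l else 0) else 0)
      + d * (O i j * (if l = k then D k else 0)) 
      + (c - d) * (if l = k then (if k = i then D k * O i j else 0) else 0)
      + (c - d) * (if l = k then (if k = j then D k * O i j else 0) else 0)
      + h * (O i j * O k l)
      + (g - h) * (if k = i then O i j * O k l else 0)
      + (g - h) * (if l = i then O i j * O k l else 0)
      + (g - h) * (if k = j then O i j * O k l else 0)
      + (g - h) * (if l = j then O i j * O k l else 0)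
      + (e - 2 * g + h) * (if k = i then (if l = j then O i j * O k l else 0) else 0)
      + (e - 2 * g + h) * (if k = j then (if l = i then O i j * O k l else 0) else 0) := by
    intro i j k l
    rw [pattern_apply hm hs1 hs2]
    by_cases hij : i = j
    · subst hij
      by_cases hkl : k = l
      · subst hkl
        by_cases hik : k = i
        · subst hik; simp [hO0]; ring
        · simp [hik, Ne.symm hik, hO0]
      · simp [hkl, Ne.symm hkl, hO0]
        split_ifs <;> first | ring1 | (simp; done) | (simp; ring1) | simp_all
    · by_cases hkl : k = l
      · subst hkl
        simp [hij, Ne.symm hij, hO0, eq_comm]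
        split_ifs <;> first | ring1 | (simp; done) | (simp; ring1) | simp_all
      · simp [hij, hkl, Ne.symm hij, Ne.symm hkl]
        split_ifs <;> ring
  simp only [e1, Finset.sum_add_distrib]
  simp only [← Finset.mul_sum]
  have swap : ∀ F : Fin n → Fin n → ℝ, ∑ i, ∑ j, F i j = ∑ j, ∑ i, F i j :=
    fun F => Finset.sum_comm
  have t1 : ∑ i, ∑ j, ∑ k, ∑ l, ((if j = i then D i else 0) * (if l = k then D k else 0))
      = (∑ i, D i)^2 := by
    simp [← Finset.mul_sum, ← Finset.sum_mul, pow_two]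
  have t2 : ∑ i, ∑ j, ∑ k, ∑ l, (if j = i then if k = i then if l = k then D i ^ 2 else 0 else 0 else 0) = ∑ i, D i ^ 2 := by
    simp 
  have t3 : ∑ i, ∑ j, ∑ k, ∑ l, ((if j = i then D i else 0) * O k l)
      = (∑ i, D i) * (∑ i, R i) := by
    simp [← Finset.mul_sum, ← Finset.sum_mul, hR]
  have t4 : ∑ i, ∑ j, ∑ k, ∑ l, (if j = i then (if k = i then D i * O k l else 0) else 0)
      = ∑ i, D i * R i := by
    simp [← Finset.mul_sum, hR, Finset.sum_ite_irrel]
  have t5 : ∑ i, ∑ j, ∑ k, ∑ l, (if j = i then (if l = i then D i * O k l else 0) else 0)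
      = ∑ i, D i * R i := by
    simp [← Finset.mul_sum, hR', Finset.sum_ite_irrel]
  have t6 : ∑ i, ∑ j, ∑ k, ∑ l, (O i j * (if l = k then D k else 0))
      = (∑ i, D i) * (∑ i, R i) := by
    simp [← Finset.mul_sum, ← Finset.sum_mul, hR, mul_comm]
  have t7 : ∑ i, ∑ j, ∑ k, ∑ l, (if l = k then (if k = i then D k * O i j else 0) else 0)
      = ∑ i, D i * R i := by
    simp [← Finset.mul_sum, hR]
  have t8 : ∑ i, ∑ j, ∑ k, ∑ l, (if l = k then (if k = j then D k * O i j else 0) else 0)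
      = ∑ i, D i * R i := by
    rw [swap]
    simp [← Finset.mul_sum, hR']
  have t9 : ∑ i, ∑ j, ∑ k, ∑ l, (O i j * O k l) = (∑ i, R i)^2 := by
    simp [← Finset.mul_sum, ← Finset.sum_mul, hR, pow_two]
  have t10 : ∑ i, ∑ j, ∑ k, ∑ l, (if k = i then O i j * O k l else 0) = ∑ i, R i^2 := by
    simp [← Finset.mul_sum, ← Finset.sum_mul, hR, pow_two, Finset.sum_ite_irrel]
  have t11 : ∑ i, ∑ j, ∑ k, ∑ l, (if l = i then O i j * O k l else 0) = ∑ i, R i^2 := by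
    simp [← Finset.mul_sum, ← Finset.sum_mul, hR, hR', pow_two, Finset.sum_ite_irrel]
  have t12 : ∑ i, ∑ j, ∑ k, ∑ l, (if k = j then O i j * O k l else 0) = ∑ i, R i^2 := by
    rw [swap]
    simp [← Finset.mul_sum, ← Finset.sum_mul, hR, hR', pow_two, Finset.sum_ite_irrel]
  have t13 : ∑ i, ∑ j, ∑ k, ∑ l, (if l = j then O i j * O k l else 0) = ∑ i, R i^2 := by
    rw [swap]
    simp [← Finset.mul_sum, ← Finset.sum_mul, hR, hR', pow_two, Finset.sum_ite_irrel]
  have t14 : ∑ i, ∑ j, ∑ k, ∑ l, (if k = i then (if l = j then O i j * O k l else 0) else 0) = ∑ i, ∑ j, O i j ^ 2 := by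
    simp [pow_two, Finset.sum_ite_irrel]
  have t15 : ∑ i, ∑ j, ∑ k, ∑ l, (if k = j then (if l = i then O i j * O k l else 0) else 0) = ∑ i, ∑ j, O i j ^ 2 := by
    simp only [pow_two, Finset.sum_ite_irrel, Finset.sum_ite_eq', Finset.mem_univ, if_true, Finset.sum_const_zero]
    refine Finset.sum_congr rfl fun i _ => Finset.sum_congr rfl fun j _ => ?_
    rw [hOs j i]
  simp only [← Finset.mul_sum] at t1 t3 t6 t9
  rw [t1, t2, t3, t4, t5, t6, t7, t8, t9, t10, t11, t12, t13, t14, t15]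
  ring

/-- value of the quartic with pattern values, in terms of normalized power sums -/
def Eform (N a b c d e g h p1 p2 p3 p4 : ℝ) : ℝ :=
  a * (N * p4) + b * (N^2 * p2^2 - N * p4)
   + 2 * (2 * c * (N^2 * p3 * p1 - N * p4)
      + d * (N * p2 * (N^2 * p1^2 - N * p2) - 2 * (N^2 * p3 * p1 - N * p4)))
   + h * (N^2 * p1^2 - N * p2)^2 + 4 * (g - h) * (N^3 * p2 * p1^2 - 2 * N^2 * p3 * p1 + N * p4)
   + 2 * (e - 2 * g + h) * (N^2 * p2^2 - N * p4)

noncomputable def Gform (N p1 p2 p3 p4 : ℝ) : ℝ :=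
  (1 / 2 : ℝ) * p1 ^ 4 - p1 ^ 2 * p2
              + ((N ^ 2 - 3 * N + 3) / (2 * N ^ 2)) * p2 ^ 2
              + ((2 * N - 2) / N ^ 2) * (p1 * p3)
              + ((1 - N) / (2 * N ^ 2)) * p4

noncomputable def Rform (N α₁₁ α₁₂ α₂₂ β₁₁ β₁₂ β₂₂ γ p1 p2 p3 p4 : ℝ) : ℝ :=
  α₁₁ * p1 ^ 4 + (2 * α₁₂) * (p1 ^ 2 * p2) + α₂₂ * p2 ^ 2
          + β₁₁ * (p1 ^ 2 * p2 - p1 ^ 4)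
          + (2 * β₁₂) * (p3 * p1 - p1 ^ 2 * p2)
          + β₂₂ * (p4 - p2 ^ 2)
          + γ * Gform N p1 p2 p3 p4

def PSD (a b c : ℝ) : Prop := ∀ s t : ℝ, 0 ≤ a * s^2 + 2 * b * s * t + c * t^2

def Conc (N a b c d e g h : ℝ) : Prop := ∃ α₁₁ α₁₂ α₂₂ β₁₁ β₁₂ β₂₂ γ : ℝ,
  PSD α₁₁ α₁₂ α₂₂ ∧ PSD β₁₁ β₁₂ β₂₂ ∧ 0 ≤ γ ∧ ∀ p1 p2 p3 p4,
    Eform N a b c d e g h p1 p2 p3 p4 = Rform N α₁₁ α₁₂ α₂₂ β₁₁ β₁₂ β₂₂ γ p1 p2 p3 p4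

lemma numbers3 (N a b c d e g h : ℝ) (hN : 3 ≤ N)
    (hL : PSD (N * (a + (N - 1) * b)) (N * (N-1) * (2 * c + (N-2) * d))
      (N * (N-1) * (2 * e + 4 * (N-2) * g + (N-2) * (N-3) * h)))
    (hK : PSD (a - b) (2 * (N-2) * (c - d)) (4 * (N-2) * (e + (N-4) * g - (N-3) * h)))
    (hG : 0 ≤ e - 2 * g + h) : Conc N a b c d e g h := by
  have h0 : 0 < N := by linarith
  have h1 : 0 < N - 1 := by linarith
  have h2 : 0 < N - 2 := by linarith
  obtain ⟨l1, hl1⟩ : ∃ x, x = (N * (a + (N - 1) * b)) := ⟨_, rfl⟩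
  obtain ⟨l2, hl2⟩ : ∃ x, x = (N * (N-1) * (2 * c + (N-2) * d)) := ⟨_, rfl⟩
  obtain ⟨l3, hl3⟩ : ∃ x, x = (N * (N-1) * (2 * e + 4 * (N-2) * g + (N-2) * (N-3) * h)) := ⟨_, rfl⟩
  obtain ⟨k1, hk1⟩ : ∃ x, x = a - b := ⟨_, rfl⟩
  obtain ⟨k2, hk2⟩ : ∃ x, x = (2 * (N-2) * (c - d)) := ⟨_, rfl⟩
  obtain ⟨k3, hk3⟩ : ∃ x, x = (4 * (N-2) * (e + (N-4) * g - (N-3) * h)) := ⟨_, rfl⟩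
  rw [← hl1, ← hl2, ← hl3] at hL
  rw [← hk1, ← hk2, ← hk3] at hK
  refine ⟨l3 * N^2 / (N-1)^2, l2 * N / (N-1) - l3 * N / (N-1)^2,
    l1 - 2 * l2 / (N-1) + l3 / (N-1)^2,
    N * k3 * N^2 / (N-2)^2, N * (k2 * N / (N-2) - k3 * N / (N-2)^2),
    N * (k1 - 2 * k2 / (N-2) + k3 / (N-2)^2),
    2 * (e - 2 * g + h) * (2 * N^4 / ((N-1) * (N-2))), ?_, ?_, by positivity, ?_⟩
  · intro s t
    have := hL t ((N * s - t) / (N-1))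
    have e : l3 * N ^ 2 / (N - 1) ^ 2 * s ^ 2 + 2 * (l2 * N / (N - 1) - l3 * N / (N - 1) ^ 2) * s * t +
      (l1 - 2 * l2 / (N - 1) + l3 / (N - 1) ^ 2) * t ^ 2 = l1 * t ^ 2 + 2 * l2 * t * ((N * s - t) / (N - 1)) + l3 * ((N * s - t) / (N - 1)) ^ 2 := by
      field_simp; ring
    rw [e]; exact this
  · intro s t
    have := mul_nonneg h0.le (hK t ((N * s - t) / (N-2)))
    have e : N * k3 * N ^ 2 / (N - 2) ^ 2 * s ^ 2 + 2 * (N * (k2 * N / (N - 2) - k3 * N / (N - 2) ^ 2)) * s * t +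
      (N * (k1 - 2 * k2 / (N - 2) + k3 / (N - 2) ^ 2)) * t ^ 2 = N * (k1 * t ^ 2 + 2 * k2 * t * ((N * s - t) / (N - 2)) + k3 * ((N * s - t) / (N - 2)) ^ 2) := by
      field_simp; ring
    rw [e]; exact this
  · intro p1 p2 p3 p4
    subst hl1 hl2 hl3 hk1 hk2 hk3
    unfold Eform Rform Gform
    field_simp
    ring

lemma numbers2 (a b c e : ℝ)
    (hL : PSD (2 * (a + b)) (2 * (2 * c)) (2 * (2 * e)))
    (hK : 0 ≤ a - b) : Conc 2 a b c c e e e := by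
  refine ⟨4 * e * 4, 4 * c * 2 - 4 * e * 2, 2 * (a + b) - 8 * c + 4 * e,
    0, 0, 2 * (a - b), 0, ?_, ?_, le_rfl, ?_⟩
  · intro s t
    have := hL t (2 * s - t)
    linarith
  · intro s t
    have := mul_nonneg hK (sq_nonneg t)
    linarith
  · intro p1 p2 p3 p4
    unfold Eform Rform Gform
    ring

lemma numbers1 (a : ℝ) (ha : 0 ≤ a) : Conc 1 a a a a a a a := by
  refine ⟨a, 0, 0, 0, 0, 0, 0, ?_, ?_, le_rfl, ?_⟩
  · intro s t
    have := mul_nonneg ha (sq_nonneg s)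
    linarith
  · intro s t; simp
  · intro p1 p2 p3 p4
    unfold Eform Rform Gform
    ring

lemma numbers0 (a b c d e g h : ℝ) : Conc 0 a b c d e g h := by
  refine ⟨0, 0, 0, 0, 0, 0, 0, ?_, ?_, le_rfl, ?_⟩
  · intro s t; simp
  · intro s t; simp
  · intro p1 p2 p3 p4
    unfold Eform Rform Gform
    ring

lemma diff_vec {n : ℕ} (p q : Fin n) (hpq : p ≠ q) :
    ∑ i, ((if i = p then (1:ℝ) else 0) - if i = q then 1 else 0) = 0 ∧
    ∑ i, ((if i = p then (1:ℝ) else 0) - if i = q then 1 else 0) ^ 2 = 2 := by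
  constructor
  · simp
  · have : ∀ i, ((if i = p then (1:ℝ) else 0) - if i = q then 1 else 0) ^ 2
      = (if i = p then (1:ℝ) else 0) + if i = q then 1 else 0 := by
      intro i
      split_ifs with h1 h2
      · exact (hpq (h1.symm.trans h2)).elim
      all_goals norm_num
    simp [this, Finset.sum_add_distrib]
    norm_num

section tests
variable {n : ℕ} {m : Fin n → Fin n → Fin n → Fin n → ℝ} {a b c d e g h : ℝ}
    (hm : Pattern m a b c d e g h) (hs1 : ∀ i j k l, m i j k l = m j i k l)
    (hs2 : ∀ i j k l, m i j k l = m k l i j)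
    (hpos : ∀ B : Fin n → Fin n → ℝ, 0 ≤ ∑ i, ∑ j, ∑ k, ∑ l, m i j k l * (B i j * B k l))

include hm hs1 hs2 hpos

lemma test_sum (D : Fin n → ℝ) (O : Fin n → Fin n → ℝ)
    (hO0 : ∀ i, O i i = 0) (hOs : ∀ i j, O i j = O j i) (R : Fin n → ℝ)
    (hR : ∀ i, ∑ j, O i j = R i) : 0 ≤ 
     a * ∑ i, D i ^ 2 + b * ((∑ i, D i)^2 - ∑ i, D i ^2)
      + 2 * (2 * c * ∑ i, D i * R i + d * ((∑ i, D i) * (∑ i, R i) - 2 * ∑ i, D i * R i))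
      + h * (∑ i, R i)^2 + 4 * (g - h) * ∑ i, R i ^ 2
      + 2 * (e - 2 * g + h) * ∑ i, ∑ j, O i j ^ 2 := by
  rw [← pattern_sum hm hs1 hs2 D O hO0 hOs R hR]
  exact hpos (fun i j => (if i = j then D i else 0) + O i j)

lemma test_L : PSD (n * (a + (n - 1) * b)) (n * (n-1) * (2 * c + (n-2) * d))
      (n * (n-1) * (2 * e + 4 * (n-2) * g + (n-2) * (n-3) * h)) := by
  intro u v
  have := test_sum hm hs1 hs2 hpos (fun _ => u) (fun i j => v - if i = j then v else 0)
    (by simp) (by intro i j; simp [eq_comm]) (fun i => (n - 1) * v) (by intro i; simp; ring)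
  have e2 : ∀ i j : Fin n, (v - if i = j then v else 0)^2 = v^2 - if i = j then v^2 else 0 := by
    intro i j; split_ifs <;> ring
  simp only [e2, Finset.sum_sub_distrib, Finset.sum_ite_eq, Finset.mem_univ, if_true,
    Finset.sum_const, Finset.card_univ, Fintype.card_fin, nsmul_eq_mul] at this
  convert this using 1
  ring

lemma test_w (w : Fin n → ℝ) (hw : ∑ i, w i = 0) (hw2 : ∑ i, w i ^ 2 = 2) :
    PSD (a - b) (2 * (n-2) * (c - d)) (4 * (n-2) * (e + (n-4) * g - (n-3) * h)) := by
  intro u v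
  have := test_sum hm hs1 hs2 hpos (fun i => u * w i)
    (fun i j => v * (w i + w j) - if i = j then v * (2 * w i) else 0)
    (by intro i; simp; ring)
    (by intro i j; by_cases h : i = j
        · simp [h]
        · simp only [h, Ne.symm h, if_false]; ring)
    (fun i => v * (n - 2) * w i)
    (by intro i; simp [← Finset.mul_sum, Finset.sum_add_distrib, hw]; ring)
  have e2 : ∀ i j : Fin n, (v * (w i + w j) - if i = j then v * (2 * w i) else 0)^2
      = v^2 * w i ^ 2 + v^2 * w j^2 + 2 * v^2 * w i * w j - if i = j then 4 * v^2 * w i ^ 2 else 0 := by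
    intro i j; split_ifs with hh
    · subst hh; ring
    · ring
  have e3 : ∀ i, u * w i * (v * (n - 2) * w i) = u * v * (n-2) * w i ^ 2 := by intro i; ring
  simp only [e2, e3, mul_pow, Finset.sum_sub_distrib, Finset.sum_ite_eq, Finset.mem_univ, if_true,
    Finset.sum_add_distrib, ← Finset.mul_sum, hw, hw2,
    Finset.sum_const, Finset.card_univ, Fintype.card_fin, nsmul_eq_mul] at this
  simp only [mul_zero, Finset.sum_const_zero] at this
  linarith [this]

lemma test_K (hn : 2 ≤ n) :
    PSD (a - b) (2 * (n-2) * (c - d)) (4 * (n-2) * (e + (n-4) * g - (n-3) * h)) := by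
  obtain ⟨h1, h2⟩ := diff_vec (⟨0, by omega⟩ : Fin n) ⟨1, by omega⟩ (by simp)
  exact test_w hm hs1 hs2 hpos _ h1 h2

lemma test_yz (y z : Fin n → ℝ) (hy : ∑ i, y i = 0) (hz : ∑ i, z i = 0) (hyz : ∀ i, y i * z i = 0)
    (hy2 : ∑ i, y i ^ 2 = 2) (hz2 : ∑ i, z i ^ 2 = 2) : 0 ≤ e - 2 * g + h := by
  have := test_sum hm hs1 hs2 hpos (fun i => 0)
    (fun i j => y i * z j + z i * y j)
    (by intro i; simp [hyz, mul_comm (z i)])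
    (by intro i j; ring)
    (fun i => 0)
    (by intro i; simp [← Finset.mul_sum, Finset.sum_add_distrib, hy, hz])
  have e2 : ∀ i j : Fin n, (y i * z j + z i * y j)^2
      = y i ^ 2 * z j ^ 2 + z i ^ 2 * y j ^ 2 := by
    intro i j
    linear_combination 2 * z j * y j * hyz i
  simp only [e2, Finset.sum_add_distrib, ← Finset.mul_sum, ← Finset.sum_mul, hy2, hz2] at this
  simp at this
  linarith

lemma test_G (hn : 4 ≤ n) : 0 ≤ e - 2 * g + h := by
  obtain ⟨h1, h2⟩ := diff_vec (⟨0, by omega⟩ : Fin n) ⟨1, by omega⟩ (by simp)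
  obtain ⟨h3, h4⟩ := diff_vec (⟨2, by omega⟩ : Fin n) ⟨3, by omega⟩ (by simp)
  refine test_yz hm hs1 hs2 hpos _ _ h1 h3 ?_ h2 h4
  rintro ⟨i, hi⟩
  simp only [Fin.mk.injEq]
  split_ifs <;> first | omega | simp

lemma conc_of_pattern : ∃ a b c d e g h, Pattern m a b c d e g h ∧ Conc n a b c d e g h := by
  rcases Nat.lt_or_ge n 4 with hn | hn
  · interval_cases n
    · refine ⟨a, b, c, d, e, g, h, hm, ?_⟩
      simpa using numbers0 a b c d e g h
    · have ha : 0 ≤ a := by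
        have := test_L hm hs1 hs2 hpos 1 0
        simpa using this
      refine ⟨a, a, a, a, a, a, a, ?_, ?_⟩
      · have hx : ∀ i j : Fin 1, i ≠ j → False := fun i j hij => hij (Subsingleton.elim _ _)
        exact ⟨hm.1, fun i j hij => (hx _ _ hij).elim, fun i j hij => (hx _ _ hij).elim,
          fun i j k hij => (hx _ _ hij).elim, fun i j hij => (hx _ _ hij).elim,
          fun i j k hij => (hx _ _ hij).elim, fun i j k l hij => (hx _ _ hij).elim⟩
      · simpa using numbers1 a ha
    · have hx : ∀ i j k : Fin 2, i ≠ j → i ≠ k → j ≠ k → False := by decide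
      have hm' : Pattern m a b c c e e e := by
        obtain ⟨h1, h2, h3, h4, h5, h6, h7⟩ := hm
        exact ⟨h1, h2, h3, fun i j k u v w => (hx i j k u v w).elim, h5,
          fun i j k u v w => (hx i j k u v w).elim, fun i j k l u v _ w => (hx i j k u v w).elim⟩
      refine ⟨a, b, c, c, e, e, e, hm', ?_⟩
      have hL := test_L hm' hs1 hs2 hpos
      have hK := test_K hm' hs1 hs2 hpos le_rfl
      have := numbers2 a b c e (by
        intro s t
        have := hL s t
        push_cast at this
        linarith) (by
        have := hK 1 0
        simpa using this)
      simpa using this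
    · have hx : ∀ i j k l : Fin 3, i ≠ j → i ≠ k → i ≠ l → j ≠ k → j ≠ l → k ≠ l → False := by
        intro i j k l; omega
      have hm' : Pattern m a b c d e g (2 * g - e) := by
        obtain ⟨h1, h2, h3, h4, h5, h6, h7⟩ := hm
        exact ⟨h1, h2, h3, h4, h5, h6, fun i j k l u v w x y z => (hx i j k l u v w x y z).elim⟩
      refine ⟨a, b, c, d, e, g, _, hm', ?_⟩
      exact numbers3 _ _ _ _ _ _ _ _ (by norm_num) (test_L hm' hs1 hs2 hpos)
        (test_K hm' hs1 hs2 hpos (by norm_num)) (by linarith)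
  · refine ⟨a, b, c, d, e, g, h, hm, ?_⟩
    have : (4 : ℝ) ≤ n := by exact_mod_cast hn
    exact numbers3 _ _ _ _ _ _ _ _ (by linarith) (test_L hm hs1 hs2 hpos)
        (test_K hm hs1 hs2 hpos (by omega)) (test_G hm hs1 hs2 hpos hn)

omit hpos
lemma eval_form (hn : n ≠ 0) (x : Fin n → ℝ) (p : ℕ → ℝ) (hp : ∀ j, p j = (n:ℝ)⁻¹ * ∑ i, x i ^ j) :
    ∑ i, ∑ j, ∑ k, ∑ l, m i j k l * ((x i * x j) * (x k * x l)) =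
      Eform n a b c d e g h (p 1) (p 2) (p 3) (p 4) := by
  have hn' : (n : ℝ) ≠ 0 := by exact_mod_cast hn
  have hP : ∀ j, ∑ i, x i ^ j = n * p j := by intro j; rw [hp]; field_simp
  have hP1 : ∑ i, x i = n * p 1 := by rw [← hP]; simp
  have := pattern_sum hm hs1 hs2 (fun i => x i ^ 2) (fun i j => x i * x j - if i = j then x i ^ 2 else 0)
    (by intro i; simp; ring)
    (by intro i j; by_cases h : i = j
        · simp [h]
        · simp [h, Ne.symm h]; ring)
    (fun i => x i * (n * p 1) - x i ^ 2)
    (by intro i; simp [← Finset.mul_sum, hP1])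
  have e1 : ∀ i j : Fin n, (if i = j then x i ^ 2 else 0) + (x i * x j - if i = j then x i ^ 2 else 0)
     = x i * x j := by intros; ring
  have e2 : ∀ i j : Fin n, (x i * x j - if i = j then x i ^ 2 else 0)^2 = x i ^ 2 * x j ^ 2
     - if i = j then x i ^ 4 else 0 := by
    intro i j; split_ifs with hh
    · subst hh; ring
    · ring
  have e3 : ∀ i, x i ^ 2 * (x i * (n * p 1) - x i ^ 2) = (n * p 1) * x i ^ 3 - x i ^ 4 := by
    intros; ring
  have e4 : ∀ i, (x i * (n * p 1) - x i ^ 2)^2 = (n * p 1)^2 * x i ^ 2 - (2 * (n * p 1)) * x i ^ 3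
    + x i ^ 4 := by intros; ring
  have e5 : ∀ i, (x i ^ 2)^2 = x i ^ 4 := by intros; ring
  simp only [e1, e2, e3, e4, e5, Finset.sum_sub_distrib, Finset.sum_add_distrib, Finset.sum_ite_eq,
    Finset.mem_univ, if_true, ← Finset.mul_sum, ← Finset.sum_mul, hP, hP1] at this
  rw [this]
  unfold Eform
  ring
end tests

lemma exists_pattern {n : ℕ} (m : Fin n → Fin n → Fin n → Fin n → ℝ)
    (h : ∀ (σ : Equiv.Perm (Fin n)) i j k l, m (σ i) (σ j) (σ k) (σ l) = m i j k l) :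
    ∃ a b c d e g h, Pattern m a b c d e g h := by
  obtain ⟨a, ha⟩ : ∃ a, ∀ i, m i i i i = a := by
    obtain ⟨c, hc⟩ := inv_tuple (k := 1) (fun v => m (v 0) (v 0) (v 0) (v 0))
      (fun σ v => h σ _ _ _ _)
    refine ⟨c, fun i => ?_⟩
    exact hc ⟨![i], by intro a b _; exact Subsingleton.elim _ _⟩
  obtain ⟨b, hb⟩ := inv2 (fun i j => m i i j j) (fun σ i j => h σ _ _ _ _)
  obtain ⟨c, hc⟩ := inv2 (fun i j => m i i i j) (fun σ i j => h σ _ _ _ _)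
  obtain ⟨d, hd⟩ := inv3 (fun i j k => m i i j k) (fun σ i j k => h σ _ _ _ _)
  obtain ⟨e, he⟩ := inv2 (fun i j => m i j i j) (fun σ i j => h σ _ _ _ _)
  obtain ⟨g, hg⟩ := inv3 (fun i j k => m i j i k) (fun σ i j k => h σ _ _ _ _)
  obtain ⟨h', hh⟩ := inv4 m h
  exact ⟨a, b, c, d, e, g, h', ha, hb, hc, hd, he, hg, hh⟩

/-- averaged kernel -/
noncomputable def avgK {n l : ℕ} (A : Fin l → Fin n → Fin n → ℝ) (i j k r : Fin n) : ℝ :=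
  (Fintype.card (Equiv.Perm (Fin n)) : ℝ)⁻¹ *
    ∑ σ : Equiv.Perm (Fin n), ∑ t, A t (σ i) (σ j) * A t (σ k) (σ r)

lemma avgK_inv {n l : ℕ} (A : Fin l → Fin n → Fin n → ℝ) (τ : Equiv.Perm (Fin n))
    (i j k r : Fin n) : avgK A (τ i) (τ j) (τ k) (τ r) = avgK A i j k r := by
  unfold avgK
  congr 1
  exact Fintype.sum_equiv (Equiv.mulRight τ) _ _ (fun σ => by simp)

lemma avgK_sum {n l : ℕ} (A : Fin l → Fin n → Fin n → ℝ) (B : Fin n → Fin n → ℝ) :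
    ∑ i, ∑ j, ∑ k, ∑ r, avgK A i j k r * (B i j * B k r) =
    (Fintype.card (Equiv.Perm (Fin n)) : ℝ)⁻¹ *
      ∑ σ : Equiv.Perm (Fin n), ∑ t, (∑ i, ∑ j, A t (σ i) (σ j) * B i j) ^ 2 := by
  have h1 : ∀ (σ : Equiv.Perm (Fin n)) t, (∑ i, ∑ j, A t (σ i) (σ j) * B i j) ^ 2 =
      ∑ i, ∑ j, ∑ k, ∑ r, A t (σ i) (σ j) * A t (σ k) (σ r) * (B i j * B k r) := by
    intro σ t
    simp only [pow_two, Finset.sum_mul]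
    simp only [Finset.mul_sum]
    refine Finset.sum_congr rfl fun i _ => Finset.sum_congr rfl fun j _ => 
      Finset.sum_congr rfl fun k _ => Finset.sum_congr rfl fun r _ => by ring
  simp only [h1]
  unfold avgK
  simp only [← Fintype.sum_prod_type' (fun (σ : Equiv.Perm (Fin n)) (t : Fin l) => _)]
  generalize (Fintype.card (Equiv.Perm (Fin n)) : ℝ)⁻¹ = K
  simp only [mul_assoc K, Finset.sum_mul]
  simp only [← Finset.mul_sum _ _ K]
  congr 1
  have sw : ∀ F : (Equiv.Perm (Fin n) × Fin l) → Fin n → ℝ, ∑ z, ∑ i, F z i = ∑ i, ∑ z, F z i :=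
    fun F => Finset.sum_comm
  simp only [sw]

lemma forward {n : ℕ}
    (f : MvPolynomial (Fin n) ℝ) (hf : f.IsSymmetric) (hf4 : f.IsHomogeneous 4)
    (hsos : ∃ (l : ℕ) (p : Fin l → MvPolynomial (Fin n) ℝ), f = ∑ t, (p t) ^ 2) :
    ∃ α₁₁ α₁₂ α₂₂ β₁₁ β₁₂ β₂₂ γ : ℝ,
      PSD α₁₁ α₁₂ α₂₂ ∧ PSD β₁₁ β₁₂ β₂₂ ∧ 0 ≤ γ ∧ 
      ∀ (x : Fin n → ℝ) (p : ℕ → ℝ) (_ : ∀ j, p j = (n:ℝ)⁻¹ * ∑ i, x i ^ j),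
      eval x f = Rform n α₁₁ α₁₂ α₂₂ β₁₁ β₁₂ β₂₂ γ (p 1) (p 2) (p 3) (p 4) := by
  obtain ⟨l, p, hp⟩ := hsos
  have hq := to_quad f hf4 p hp
  choose A hAs hA using fun t => quad_form _ (homogeneousComponent_isHomogeneous 2 (p t))
  have hev : ∀ x, eval x f = ∑ i, ∑ j, ∑ k, ∑ r, avgK A i j k r * ((x i * x j) * (x k * x r)) := by
    intro x
    rw [avgK_sum A (fun i j => x i * x j)]
    have h1 : ∀ σ : Equiv.Perm (Fin n),
        ∑ t, (∑ i, ∑ j, A t (σ i) (σ j) * (x i * x j)) ^ 2 = eval x f := by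
      intro σ
      have h2 : eval x f = eval (x ∘ σ.symm) f := by
        conv_lhs => rw [← hf σ.symm]
        rw [eval_rename]
      rw [h2, hq]
      refine Finset.sum_congr rfl fun t _ => ?_
      rw [hA]
      congr 1
      refine Fintype.sum_equiv σ _ _ fun i => ?_
      refine Fintype.sum_equiv σ _ _ fun j => ?_
      simp
    simp only [h1, Finset.sum_const, Finset.card_univ, nsmul_eq_mul]
    have : (Fintype.card (Equiv.Perm (Fin n)) : ℝ) ≠ 0 := by
      exact_mod_cast Fintype.card_ne_zero
    field_simp
  have hpos : ∀ B : Fin n → Fin n → ℝ,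
      0 ≤ ∑ i, ∑ j, ∑ k, ∑ r, avgK A i j k r * (B i j * B k r) := by
    intro B
    rw [avgK_sum]
    positivity
  have hs1 : ∀ i j k r, avgK A i j k r = avgK A j i k r := by
    intro i j k r; unfold avgK
    simp only [fun t (σ : Equiv.Perm (Fin n)) => hAs t (σ i) (σ j)]
  have hs2 : ∀ i j k r, avgK A i j k r = avgK A k r i j := by
    intro i j k r; unfold avgK
    simp only [mul_comm]
  obtain ⟨a, b, c, d, e, g, h, hm⟩ := exists_pattern (avgK A) (avgK_inv A)
  obtain ⟨a, b, c, d, e, g, h, hm, α₁₁, α₁₂, α₂₂, β₁₁, β₁₂, β₂₂, γ, hα, hβ, hγ, hR⟩ :=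
    conc_of_pattern hm hs1 hs2 hpos
  refine ⟨α₁₁, α₁₂, α₂₂, β₁₁, β₁₂, β₂₂, γ, hα, hβ, hγ, fun x p hp => ?_⟩
  rw [hev, ← hR]
  rcases Nat.eq_zero_or_pos n with rfl | hn
  · simp [Eform]
  · exact eval_form hm hs1 hs2 hn.ne' x p hp

lemma sos_of_isSumSq {n : ℕ} {f : MvPolynomial (Fin n) ℝ} (h : IsSumSq f) :
    ∃ (l : ℕ) (p : Fin l → MvPolynomial (Fin n) ℝ), f = ∑ t, (p t) ^ 2 := by
  induction h with
  | zero => exact ⟨0, fun _ => 0, by simp⟩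
  | sq_add a _ ih =>
    obtain ⟨l, p, rfl⟩ := ih
    exact ⟨l + 1, Fin.cons a p, by simp [Fin.sum_univ_succ, pow_two]⟩

lemma isSumSq_C {n : ℕ} (c : ℝ) (hc : 0 ≤ c) {f : MvPolynomial (Fin n) ℝ} (hf : IsSumSq f) :
    IsSumSq (C c * f) := by
  have : IsSumSq (C c : MvPolynomial (Fin n) ℝ) := by
    have : (C c : MvPolynomial (Fin n) ℝ) = C √c * C √c := by
      rw [← C_mul, Real.mul_self_sqrt hc]
    rw [this]; exact IsSumSq.mul_self _
  exact this.mul hf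

lemma isSumSq_sq {n : ℕ} (f : MvPolynomial (Fin n) ℝ) : IsSumSq (f ^ 2) := by
  rw [pow_two]; exact IsSumSq.mul_self _

lemma isSumSq_sum {n : ℕ} {ι : Type} (s : Finset ι) (F : ι → MvPolynomial (Fin n) ℝ)
    (h : ∀ i ∈ s, IsSumSq (F i)) : IsSumSq (∑ i ∈ s, F i) :=
  Finset.sum_induction _ IsSumSq (fun _ _ => IsSumSq.add) IsSumSq.zero h

section back
variable {n : ℕ} (hn : n ≠ 0) (x : Fin n → ℝ) (p : ℕ → ℝ)
  (hp : ∀ j, p j = (n:ℝ)⁻¹ * ∑ i, x i ^ j)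
include hn hp

lemma sum_quartic (a0 a1 a2 a3 a4 : ℝ) :
    ∑ i, (a0 + a1 * x i + a2 * x i ^ 2 + a3 * x i ^ 3 + a4 * x i ^ 4)
      = n * (a0 + a1 * p 1 + a2 * p 2 + a3 * p 3 + a4 * p 4) := by
  have hn' : (n : ℝ) ≠ 0 := by exact_mod_cast hn
  have hP : ∀ j, ∑ i, x i ^ j = n * p j := by intro j; rw [hp]; field_simp
  have hP1 : ∑ i, x i = n * p 1 := by rw [← hP]; simp
  simp only [Finset.sum_add_distrib, ← Finset.mul_sum, hP, hP1]
  simp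
  ring

lemma beta_sum (P r w : ℝ) :
    (n:ℝ)⁻¹ * ∑ i, ((P * (p 1 * (x i - p 1)) + r * (x i ^ 2 - p 2))^2 + (w * (x i ^ 2 - p 2))^2)
    = P^2 * (p 1 ^ 2 * p 2 - p 1 ^ 4) + 2 * (P * r) * (p 3 * p 1 - p 1 ^ 2 * p 2)
      + (r^2 + w^2) * (p 4 - p 2 ^ 2) := by
  have hn' : (n : ℝ) ≠ 0 := by exact_mod_cast hn
  have := sum_quartic hn x p hp ((P * p 1 ^ 2 + r * p 2)^2 + w^2 * p 2 ^2)
    (-2 * P * p 1 * (P * p 1 ^ 2 + r * p 2))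
    (P^2 * p 1 ^2 - 2 * r * (P * p 1 ^2 + r * p 2) - 2 * w^2 * p 2) (2 * P * p 1 * r) (r^2 + w^2)
  rw [inv_mul_eq_iff_eq_mul₀ hn']
  refine (Eq.trans ?_ this).trans ?_
  · refine Finset.sum_congr rfl fun i _ => by ring
  · ring

/-- M_ij off the diagonal -/
lemma gamma_sum (A B D : ℝ) :
    ∑ i, ∑ j, (if i = j then 0 else (x i * x j + (A + B * x i + D * x i ^ 2) +
      (A + B * x j + D * x j ^ 2)) ^ 2) =
    n^2 * p 2 ^ 2 + 2 * n * (n * (A^2 + 2 * A * B * p 1 + (B^2 + 2 * A * D) * p 2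
       + 2 * B * D * p 3 + D^2 * p 4)) + 2 * (n * (A + B * p 1 + D * p 2))^2
    + 4 * (n * (A * p 1 + B * p 2 + D * p 3)) * (n * p 1)
    - n * (4 * A ^ 2 + 8 * A * B * p 1 + (4 * B^2 + 4 * A * (1 + 2 * D)) * p 2
      + 4 * B * (1 + 2 * D) * p 3 + (1 + 2 * D)^2 * p 4) := by
  have h1 : ∀ i j, (if i = j then 0 else (x i * x j + (A + B * x i + D * x i ^ 2) +
      (A + B * x j + D * x j ^ 2)) ^ 2) = (x i * x j + (A + B * x i + D * x i ^ 2) +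
      (A + B * x j + D * x j ^ 2)) ^ 2 - if i = j then (x i ^ 2 + 2 * (A + B * x i + D * x i ^ 2))^2 else 0 := by
    intro i j; split_ifs with h
    · subst h; ring
    · ring
  have h2 : ∀ i, ∑ j, (x i * x j + (A + B * x i + D * x i ^ 2) + (A + B * x j + D * x j ^ 2)) ^ 2
     = n * ((A + B * x i + D * x i ^ 2 + A)^2 + 2 * (A + B * x i + D * x i ^ 2 + A) * (x i + B) * p 1
       + ((x i + B)^2 + 2 * (A + B * x i + D * x i ^ 2 + A) * D) * p 2 + 2 * (x i + B) * D * p 3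
       + D^2 * p 4) := by
    intro i
    rw [← sum_quartic hn x p hp]
    refine Finset.sum_congr rfl fun j _ => by ring
  simp only [h1, Finset.sum_sub_distrib, h2, Finset.sum_ite_eq, Finset.mem_univ, if_true]
  have h3 : ∑ i, (x i ^ 2 + 2 * (A + B * x i + D * x i ^ 2))^2 = n * (4 * A ^ 2 + 8 * A * B * p 1 + (4 * B^2 + 4 * A * (1 + 2 * D)) * p 2
      + 4 * B * (1 + 2 * D) * p 3 + (1 + 2 * D)^2 * p 4) := by
    rw [← sum_quartic hn x p hp]
    refine Finset.sum_congr rfl fun j _ => by ring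
  rw [h3]
  congr 1
  rw [← Finset.mul_sum]
  have h4 := sum_quartic hn x p hp 
    (4 * A^2 + 4 * A * B * p 1 + (B^2 + 4 * A * D) * p 2 + 2 * B * D * p 3 + D^2 * p 4)
    (4 * A * B + (2 * B^2 + 4 * A) * p 1 + (2 * B + 2 * B * D) * p 2 + 2 * D * p 3)
    (B^2 + 4 * A * D + (2 * B + 2 * D * B) * p 1 + (1 + 2 * D^2) * p 2)
    (2 * B * D + 2 * D * p 1) (D^2)
  rw [show ∑ i, ((A + B * x i + D * x i ^ 2 + A)^2 + 2 * (A + B * x i + D * x i ^ 2 + A) * (x i + B) * p 1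
       + ((x i + B)^2 + 2 * (A + B * x i + D * x i ^ 2 + A) * D) * p 2 + 2 * (x i + B) * D * p 3
       + D^2 * p 4) = _ from (Finset.sum_congr rfl fun i _ => by ring).trans h4]
  ring

lemma G_eq (h3 : 3 ≤ n) : Gform n (p 1) (p 2) (p 3) (p 4) =
    (((n:ℝ) - 1) * (n - 2) / (2 * n ^ 4)) *
    ∑ i, ∑ j, (if i = j then 0 else (x i * x j + 
      ((-((n * p 1 ^ 2 - p 2) / (n - 1)) / 2 + (n * p 1 ^ 2 - p 2) / (n - 2))
        + (- (n * p 1 / (n - 2))) * x i + (1 / (n - 2)) * x i ^ 2) +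
      ((-((n * p 1 ^ 2 - p 2) / (n - 1)) / 2 + (n * p 1 ^ 2 - p 2) / (n - 2))
        + (- (n * p 1 / (n - 2))) * x j + (1 / (n - 2)) * x j ^ 2)) ^ 2) := by
  rw [gamma_sum hn x p hp]
  have h3' : (3:ℝ) ≤ n := by exact_mod_cast h3
  have h0 : (n:ℝ) ≠ 0 := by positivity
  have h1 : (n:ℝ) - 1 ≠ 0 := by intro h; linarith
  have h2 : (n:ℝ) - 2 ≠ 0 := by intro h; linarith
  unfold Gform
  field_simp
  ring

omit hn
lemma G_small (h3 : n < 3) : Gform n (p 1) (p 2) (p 3) (p 4) = 0 := by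
  interval_cases n
  · simp [Gform, hp]
  · simp [Gform, hp]; ring
  · simp [Gform, hp, Fin.sum_univ_two]; ring
end back

lemma backward {n : ℕ} (f : MvPolynomial (Fin n) ℝ)
    (π : ℕ → MvPolynomial (Fin n) ℝ)
    (hπ : ∀ j, π j = MvPolynomial.C ((n : ℝ)⁻¹) * ∑ i, X i ^ j)
    (α₁₁ α₁₂ α₂₂ β₁₁ β₁₂ β₂₂ γ : ℝ) (hα : PSD α₁₁ α₁₂ α₂₂) (hβ : PSD β₁₁ β₁₂ β₂₂) (hγ : 0 ≤ γ)
    (hf : ∀ x : Fin n → ℝ, eval x f = Rform n α₁₁ α₁₂ α₂₂ β₁₁ β₁₂ β₂₂ γ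
      (eval x (π 1)) (eval x (π 2)) (eval x (π 3)) (eval x (π 4))) : IsSumSq f := by
  have hp : ∀ x : Fin n → ℝ, ∀ j, eval x (π j) = (n : ℝ)⁻¹ * ∑ i, x i ^ j := by
    intro x j; rw [hπ]; simp
  rcases eq_or_ne n 0 with rfl | hn
  · have : f = 0 := by
      apply MvPolynomial.funext; intro x
      rw [hf]; simp [Rform, Gform, hp]
    rw [this]; exact IsSumSq.zero
  obtain ⟨P, r, w, rfl, rfl, rfl⟩ := psd_factor _ _ _ hα
  obtain ⟨P', r', w', rfl, rfl, rfl⟩ := psd_factor _ _ _ hβ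
  obtain ⟨G, hG, hGe⟩ : ∃ G : MvPolynomial (Fin n) ℝ, IsSumSq G ∧ ∀ x, eval x G =
      Gform n (eval x (π 1)) (eval x (π 2)) (eval x (π 3)) (eval x (π 4)) := by
    rcases Nat.lt_or_ge n 3 with h3 | h3
    · exact ⟨0, IsSumSq.zero, fun x => by rw [G_small x (fun j => eval x (π j)) (hp x) h3]; simp⟩
    · have h3' : (3:ℝ) ≤ n := by exact_mod_cast h3
      set φ : Fin n → MvPolynomial (Fin n) ℝ := fun i => 
        (C (-1 / (2 * ((n:ℝ) - 1)) + 1 / ((n:ℝ) - 2)) * (C (n:ℝ) * π 1 ^ 2 - π 2)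
        + (- (C ((n:ℝ) / ((n:ℝ) - 2)) * π 1)) * X i + C (1 / ((n:ℝ) - 2)) * X i ^ 2) with hφ
      refine ⟨C (((n:ℝ) - 1) * (n - 2) / (2 * n ^ 4)) * ∑ i, ∑ j,
        (if i = j then 0 else (X i * X j + φ i + φ j)^2), ?_, ?_⟩
      · apply isSumSq_C
        · have : (0:ℝ) ≤ n - 1 := by linarith
          have : (0:ℝ) ≤ n - 2 := by linarith
          positivity
        · refine isSumSq_sum _ _ fun i _ => isSumSq_sum _ _ fun j _ => ?_
          split_ifs
          · exact IsSumSq.zero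
          · exact isSumSq_sq _
      · intro x
        rw [G_eq hn x (fun j => eval x (π j)) (hp x) h3]
        rw [map_mul, eval_C, map_sum]
        congr 1
        refine Finset.sum_congr rfl fun i _ => ?_
        rw [map_sum]
        refine Finset.sum_congr rfl fun j _ => ?_
        split_ifs
        · simp
        · have h1 : (n:ℝ) - 1 ≠ 0 := by intro h; linarith
          have h2 : (n:ℝ) - 2 ≠ 0 := by intro h; linarith
          simp only [hφ, map_pow, map_add, map_mul, map_neg, map_sub, eval_C, eval_X]
          congr 1
          field_simp
  have key : f = (C P * π 1 ^ 2 + C r * π 2)^2 + (C w * π 2)^2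
    + C ((n:ℝ)⁻¹) * ∑ i, ((C P' * (π 1 * (X i - π 1)) + C r' * (X i ^ 2 - π 2))^2
        + (C w' * (X i ^ 2 - π 2))^2) + C γ * G := by
    apply MvPolynomial.funext
    intro x
    have hb := beta_sum hn x (fun j => eval x (π j)) (hp x) P' r' w'
    rw [hf]
    simp only [map_add, map_mul, map_pow, map_sum, map_sub, eval_C, eval_X, hGe]
    rw [hb]
    unfold Rform
    ring
  rw [key]
  refine (((isSumSq_sq _).add (isSumSq_sq _)).add (isSumSq_C _ (by positivity) ?_)).add
    (isSumSq_C _ hγ hG)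
  exact isSumSq_sum _ _ fun i _ => (isSumSq_sq _).add (isSumSq_sq _)

/-- **Characterization of symmetric quartic sums of squares (Blekherman–Riener).**
Let `f` be a homogeneous symmetric polynomial of degree `4` in `n` variables and let
`π_j = (1/n)(X_1^j + ⋯ + X_n^j)` be the normalized power sums.  Then `f` is a sum of
squares if and only if it admits the stated representation with two positive semidefinite
`2×2` coefficient matrices and a nonnegative coefficient `γ`. -/
theorem symmetric_quartic_sos_characterization {n : ℕ}
    (f : MvPolynomial (Fin n) ℝ) (hf : f.IsSymmetric) (hf4 : f.IsHomogeneous 4)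
    (π : ℕ → MvPolynomial (Fin n) ℝ)
    (hπ : ∀ j, π j = MvPolynomial.C ((n : ℝ)⁻¹) * ∑ i, X i ^ j) :
    (∃ (l : ℕ) (p : Fin l → MvPolynomial (Fin n) ℝ), f = ∑ t, (p t) ^ 2) ↔
      ∃ α₁₁ α₁₂ α₂₂ β₁₁ β₁₂ β₂₂ γ : ℝ,
        (Matrix.of ![![α₁₁, α₁₂], ![α₁₂, α₂₂]]).PosSemidef ∧
        (Matrix.of ![![β₁₁, β₁₂], ![β₁₂, β₂₂]]).PosSemidef ∧
        0 ≤ γ ∧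
        f = α₁₁ • π 1 ^ 4 + (2 * α₁₂) • (π 1 ^ 2 * π 2) + α₂₂ • π 2 ^ 2
          + β₁₁ • (π 1 ^ 2 * π 2 - π 1 ^ 4)
          + (2 * β₁₂) • (π 3 * π 1 - π 1 ^ 2 * π 2)
          + β₂₂ • (π 4 - π 2 ^ 2)
          + γ • ((1 / 2 : ℝ) • π 1 ^ 4 - π 1 ^ 2 * π 2
              + (((n : ℝ) ^ 2 - 3 * n + 3) / (2 * (n : ℝ) ^ 2)) • π 2 ^ 2
              + ((2 * (n : ℝ) - 2) / (n : ℝ) ^ 2) • (π 1 * π 3)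
              + ((1 - (n : ℝ)) / (2 * (n : ℝ) ^ 2)) • π 4) := by
  have hev : ∀ (x : Fin n → ℝ) (α₁₁ α₁₂ α₂₂ β₁₁ β₁₂ β₂₂ γ : ℝ),
      eval x (α₁₁ • π 1 ^ 4 + (2 * α₁₂) • (π 1 ^ 2 * π 2) + α₂₂ • π 2 ^ 2
          + β₁₁ • (π 1 ^ 2 * π 2 - π 1 ^ 4)
          + (2 * β₁₂) • (π 3 * π 1 - π 1 ^ 2 * π 2)
          + β₂₂ • (π 4 - π 2 ^ 2)
          + γ • ((1 / 2 : ℝ) • π 1 ^ 4 - π 1 ^ 2 * π 2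
              + (((n : ℝ) ^ 2 - 3 * n + 3) / (2 * (n : ℝ) ^ 2)) • π 2 ^ 2
              + ((2 * (n : ℝ) - 2) / (n : ℝ) ^ 2) • (π 1 * π 3)
              + ((1 - (n : ℝ)) / (2 * (n : ℝ) ^ 2)) • π 4))
      = Rform n α₁₁ α₁₂ α₂₂ β₁₁ β₁₂ β₂₂ γ
        (eval x (π 1)) (eval x (π 2)) (eval x (π 3)) (eval x (π 4)) := by
    intros
    simp only [map_add, map_mul, map_pow, map_sub, smul_eval, Rform, Gform]
  constructor
  · intro hsos
    obtain ⟨α₁₁, α₁₂, α₂₂, β₁₁, β₁₂, β₂₂, γ, hα, hβ, hγ, h⟩ := forward f hf hf4 hsos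
    refine ⟨α₁₁, α₁₂, α₂₂, β₁₁, β₁₂, β₂₂, γ, (psd_iff _ _ _).2 hα, (psd_iff _ _ _).2 hβ, hγ, ?_⟩
    apply MvPolynomial.funext
    intro x
    rw [hev, h x (fun j => eval x (π j))]
    intro j; rw [hπ]; simp
  · rintro ⟨α₁₁, α₁₂, α₂₂, β₁₁, β₁₂, β₂₂, γ, hα, hβ, hγ, h⟩
    refine sos_of_isSumSq (backward f π hπ α₁₁ α₁₂ α₂₂ β₁₁ β₁₂ β₂₂ γ ((psd_iff _ _ _).1 hα)
      ((psd_iff _ _ _).1 hβ) hγ fun x => ?_)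
    rw [← hev, ← h]
end
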